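/- arXiv:2108.03417 — 2 statements merged into one kernel-verified Lean document; each statement's English description precedes it below -/
import Mathlib

section
/- Let α ∈ (1,2) and θ ∈ (0, 1/(2α)). There exists C > 0, depending only on α and θ, such that for every sequence (λ_n) of positive reals, all real sequences (a_n), (b_n), and every t > 0: ∑_n λ_n^{3/2+2θ} | a_n E_α(−λ_n t^α) + b_n t E_{α,2}(−λ_n t^α) |² ≤ C t^{−2αθ} ∑_n λ_n^{3/2} a_n² + C t^{2−α(1+2θ)} ∑_n λ_n^{1/2} b_n²; consequently, for every T > 0 the left-hand side is integrable in t over (0,T). (This is the estimate yielding ∇Δu ∈ L²(0,T; D(A^θ)) with ‖∇Δu‖_{L²(0,T;D(A^θ))} ≤ C(‖∇Δu_0‖ + ‖∇u_1‖) for the solution series of the fractional Petrovsky system.) -/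
open MeasureTheory

/-- The Mittag-Leffler function `E_{α,β}(x) = ∑_{k=0}^∞ x^k / Γ(αk + β)` for real `x`. -/
noncomputable def mittagLeffler (α β x : ℝ) : ℝ :=
  ∑' k : ℕ, x ^ k / Real.Gamma (α * k + β)


lemma pt_integ (a c : ℝ) (ha : 0 < a) (hc : 0 < c) :
    IntegrableOn (fun t : ℝ => t ^ a * Real.exp (-c * t)) (Set.Ioi 0) := by
  have := integrableOn_rpow_mul_exp_neg_mul_rpow (p := 1) (s := a) (b := c) (by linarith) one_pos hc
  simpa using this

lemma pt_laplace (a : ℝ) (ha : 0 < a) (p : ℂ) (hp : 0 < p.re) :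
    ∫ t in Set.Ioi (0:ℝ), ((t ^ a : ℝ) : ℂ) * Complex.exp (-p * t) =
      p ^ ((-(a+1) : ℝ) : ℂ) * (Real.Gamma (a+1) : ℂ) := by
  set μ : Measure ℝ := (volume.restrict (Set.Ioi (0:ℝ))).withDensity
    (fun t => ENNReal.ofReal (t ^ a)) with hμ
  have hmeas : Measurable (fun t : ℝ => ENNReal.ofReal (t ^ a)) := by fun_prop
  have hI : ∀ z : ℂ, ProbabilityTheory.complexMGF id μ z =
      ∫ t in Set.Ioi (0:ℝ), ((t ^ a : ℝ) : ℂ) * Complex.exp (z * t) := by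
    intro z
    rw [ProbabilityTheory.complexMGF, hμ,
      integral_withDensity_eq_integral_toReal_smul hmeas (by simp)]
    refine setIntegral_congr_fun measurableSet_Ioi (fun t ht => ?_)
    simp only [id]
    rw [ENNReal.toReal_ofReal (Real.rpow_nonneg (le_of_lt ht) _), Complex.real_smul]
  have hset : Set.Iio (0:ℝ) ⊆ ProbabilityTheory.integrableExpSet id μ := by
    intro x hx
    simp only [ProbabilityTheory.integrableExpSet, Set.mem_ofPred_eq]
    rw [hμ, integrable_withDensity_iff_integrable_smul' hmeas (by simp)]
    have := pt_integ a (-x) ha (by simpa using hx)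
    refine this.congr_fun_ae ?_
    refine (ae_restrict_iff' measurableSet_Ioi).2 (Filter.Eventually.of_forall fun t ht => ?_)
    simp only [id]
    rw [ENNReal.toReal_ofReal (Real.rpow_nonneg (le_of_lt ht) _), smul_eq_mul, neg_neg]
  have hint : Set.Iio (0:ℝ) ⊆ interior (ProbabilityTheory.integrableExpSet id μ) :=
    interior_maximal hset isOpen_Iio
  have hopen : IsOpen {z : ℂ | 0 < z.re} := isOpen_lt continuous_const Complex.continuous_re
  have h1 : AnalyticOnNhd ℂ (fun p => ProbabilityTheory.complexMGF id μ (-p)) {z : ℂ | 0 < z.re} := by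
    refine DifferentiableOn.analyticOnNhd ?_ hopen
    intro z hz
    have : DifferentiableAt ℂ (ProbabilityTheory.complexMGF id μ) (-z) :=
      (ProbabilityTheory.hasDerivAt_complexMGF (hint (by simpa using hz))).differentiableAt
    exact (this.comp z (differentiableAt_id.neg)).differentiableWithinAt
  have h2 : AnalyticOnNhd ℂ (fun p : ℂ => p ^ ((-(a+1) : ℝ) : ℂ) * (Real.Gamma (a+1) : ℂ))
      {z : ℂ | 0 < z.re} := by
    refine DifferentiableOn.analyticOnNhd ?_ hopen
    intro z hz
    have : z ∈ Complex.slitPlane := Or.inl hz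
    exact ((differentiableAt_id.cpow_const this).mul_const _).differentiableWithinAt
  have hconv : IsPreconnected {z : ℂ | 0 < z.re} :=
    (convex_halfSpace_re_gt 0).isPreconnected
  have hreal : ∀ r : ℝ, 0 < r → ProbabilityTheory.complexMGF id μ (-(r:ℂ)) =
      (r:ℂ) ^ ((-(a+1) : ℝ) : ℂ) * (Real.Gamma (a+1) : ℂ) := by
    intro r hr
    rw [hI]
    have := Real.integral_rpow_mul_exp_neg_mul_Ioi (a := a + 1) (by linarith) hr
    rw [← Complex.ofReal_cpow hr.le, ← Complex.ofReal_mul, Real.rpow_neg hr.le,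
      ← Real.inv_rpow hr.le, ← one_div, ← this, ← integral_complex_ofReal]
    refine setIntegral_congr_fun measurableSet_Ioi (fun t ht => ?_)
    simp
  have key := h1.eqOn_of_preconnected_of_frequently_eq h2 hconv (z₀ := 1) (by simp) (by
    have ht : Filter.Tendsto (fun r : ℝ => (r:ℂ)) (nhdsWithin 1 {1}ᶜ) (nhdsWithin 1 {1}ᶜ) := by
      refine tendsto_nhdsWithin_of_tendsto_nhds_of_eventually_within _ ?_ ?_
      · exact (Complex.continuous_ofReal.tendsto' 1 1 (by simp)).mono_left nhdsWithin_le_nhds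
      · filter_upwards [self_mem_nhdsWithin] with r hr
        simpa using hr
    refine ht.frequently (Filter.Eventually.frequently ?_)
    filter_upwards [nhdsWithin_le_nhds (Ioi_mem_nhds (zero_lt_one (α := ℝ)))] with r hr
    exact hreal r hr)
  have := key (x := p) hp
  simp only at this
  rw [← this, hI]

lemma pt_normc (y : ℝ) : ‖(2:ℂ) + y * Complex.I‖ ^ 2 = 4 + y ^ 2 := by
  rw [← Complex.normSq_eq_norm_sq]; simp [Complex.normSq_apply]; ring

lemma pt_ne (y : ℝ) : (2:ℂ) + y * Complex.I ≠ 0 := by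
  intro h; have := congrArg Complex.re h; simp at this

lemma pt_vert_le (r y : ℝ) (hr : 0 ≤ r) :
    ‖((2:ℂ) + y * Complex.I) ^ ((-r : ℝ) : ℂ)‖ ≤ (1 + ‖y‖ ^ 2) ^ (-r/2) := by
  rw [Complex.norm_cpow_real]
  have h := pt_normc y
  have h0 : 0 ≤ ‖(2:ℂ) + y * Complex.I‖ := norm_nonneg _
  have : ‖(2:ℂ) + y * Complex.I‖ ^ (-r) = (4 + y^2) ^ (-r/2) := by
    rw [← h, ← Real.rpow_natCast, ← Real.rpow_mul h0]; congr 1; push_cast; ring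
  rw [this, Real.norm_eq_abs, sq_abs]
  exact Real.rpow_le_rpow_of_nonpos (by positivity) (by linarith) (by linarith)

lemma pt_vert_cont (r : ℝ) :
    Continuous (fun y : ℝ => ((2:ℂ) + y * Complex.I) ^ ((-r : ℝ) : ℂ)) := by
  refine Continuous.cpow (by fun_prop) continuous_const (fun y => Or.inl (by simp))

lemma pt_jap (r : ℝ) (hr : 1 < r) : Integrable (fun y : ℝ => (1 + ‖y‖ ^ 2) ^ (-r/2)) :=
  integrable_rpow_neg_one_add_norm_sq (by simpa using hr)

lemma pt_vert_integ (r : ℝ) (hr : 1 < r) :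
    Integrable (fun y : ℝ => ((2:ℂ) + y * Complex.I) ^ ((-r : ℝ) : ℂ)) :=
  (pt_jap r hr).mono' (pt_vert_cont r).aestronglyMeasurable
    (Filter.Eventually.of_forall fun y => pt_vert_le r y (by linarith))

open FourierTransform in
lemma pt_invGamma (a s : ℝ) (ha : 0 < a) (hs : 0 < s) :
    ∫ y : ℝ, Complex.exp (((2:ℂ) + y * Complex.I) * s) *
      ((2:ℂ) + y * Complex.I) ^ ((-(a+1) : ℝ) : ℂ) =
      ((2 * Real.pi * (s ^ a / Real.Gamma (a+1)) : ℝ) : ℂ) := by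
  set f : ℝ → ℂ := (Set.Ioi (0:ℝ)).indicator
    (fun t => ((t ^ a * Real.exp (-2 * t) : ℝ) : ℂ)) with hf
  have hfi : Integrable f := by
    rw [hf, integrable_indicator_iff measurableSet_Ioi]
    exact (pt_integ a 2 ha two_pos).ofReal
  have hF : ∀ w : ℝ, 𝓕 f w = ((2:ℂ) + ((2 * Real.pi * w : ℝ)) * Complex.I) ^ ((-(a+1) : ℝ) : ℂ)
      * (Real.Gamma (a+1) : ℂ) := by
    intro w
    rw [Real.fourier_real_eq_integral_exp_smul, ← pt_laplace a ha _ (by simp),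
      ← integral_indicator measurableSet_Ioi]
    congr 1
    ext t
    by_cases ht : t ∈ Set.Ioi (0:ℝ)
    · rw [hf, Set.indicator_of_mem ht, Set.indicator_of_mem ht, smul_eq_mul]
      push_cast
      rw [mul_left_comm, ← Complex.exp_add]
      congr 2; ring
    · rw [hf, Set.indicator_of_notMem ht, Set.indicator_of_notMem ht, smul_zero]
  have hFi : Integrable (𝓕 f) := by
    have h1 := (pt_vert_integ (a+1) (by linarith)).comp_mul_left' (R := 2 * Real.pi) (by positivity)
    have := h1.mul_const (Real.Gamma (a+1) : ℂ)
    refine this.congr (Filter.Eventually.of_forall fun w => ?_)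
    exact (hF w).symm
  have hc : ContinuousAt f s := by
    have : f =ᶠ[nhds s] fun t => ((t ^ a * Real.exp (-2 * t) : ℝ) : ℂ) := by
      filter_upwards [Ioi_mem_nhds hs] with t ht
      rw [hf, Set.indicator_of_mem ht]
    refine ContinuousAt.congr ?_ this.symm
    refine Complex.continuous_ofReal.continuousAt.comp ?_
    exact (Real.continuousAt_rpow_const _ _ (Or.inl hs.ne')).mul (by fun_prop)
  have inv := hfi.fourierInv_fourier_eq hFi hc
  have hG : (Real.Gamma (a+1) : ℂ) ≠ 0 := by
    exact_mod_cast (Real.Gamma_pos_of_pos (by linarith)).ne'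
  rw [Real.fourierInv_eq', hf, Set.indicator_of_mem (show s ∈ Set.Ioi (0:ℝ) from hs)] at inv
  have sub := Measure.integral_comp_mul_left (fun y : ℝ => Complex.exp (((2:ℂ) + y * Complex.I) * s) *
      ((2:ℂ) + y * Complex.I) ^ ((-(a+1) : ℝ) : ℂ)) (2 * Real.pi)
  have hpi : (0:ℝ) < 2 * Real.pi := by positivity
  have e1 : ∫ w : ℝ, Complex.exp (((2:ℂ) + ((2 * Real.pi * w : ℝ)) * Complex.I) * s) *
      ((2:ℂ) + ((2 * Real.pi * w : ℝ)) * Complex.I) ^ ((-(a+1) : ℝ) : ℂ)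
      = ((s ^ a / Real.Gamma (a+1) : ℝ) : ℂ) := by
    have : ∀ w : ℝ, Complex.exp (((2:ℂ) + ((2 * Real.pi * w : ℝ)) * Complex.I) * s) *
      ((2:ℂ) + ((2 * Real.pi * w : ℝ)) * Complex.I) ^ ((-(a+1) : ℝ) : ℂ) =
      (Complex.exp (2 * s) / (Real.Gamma (a+1) : ℂ)) *
        (Complex.exp ((2 * Real.pi * inner ℝ w s : ℝ) * Complex.I) • 𝓕 f w) := by
      intro w
      rw [hF, smul_eq_mul]
      have : ((2:ℂ) + ((2 * Real.pi * w : ℝ)) * Complex.I) * s =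
        2 * s + (2 * Real.pi * inner ℝ w s : ℝ) * Complex.I := by
        simp; ring
      rw [this, Complex.exp_add]
      field_simp
    simp_rw [this]
    rw [integral_const_mul, inv]
    push_cast
    rw [div_mul_eq_mul_div, mul_left_comm, ← Complex.exp_add]
    congr 1
    rw [show (2 * (s:ℂ) + -2 * s) = 0 by ring]; simp
  rw [e1] at sub
  rw [abs_of_pos (inv_pos.2 hpi), eq_comm, inv_smul_eq_iff₀ hpi.ne'] at sub
  rw [sub]; simp

noncomputable def ptG (α β : ℝ) (p : ℂ) : ℂ :=
  p ^ ((-(β+1) : ℝ) : ℂ) * (β * p ^ (α:ℂ) / (p ^ (α:ℂ) + 1) - α * p ^ (α:ℂ) / (p ^ (α:ℂ) + 1) ^ 2)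

lemma pt_lower (α : ℝ) (hα₁ : 1 < α) (hα₂ : α < 2) : ∃ δ > (0:ℝ), ∀ p : ℂ, 0 < p.re →
    δ * (1 + ‖p‖ ^ α) ≤ ‖p ^ (α:ℂ) + 1‖ := by
  set κ := Real.cos (α * (Real.pi / 2)) with hκ
  have hpi := Real.pi_pos
  have hκ1 : -1 < κ := by
    rw [hκ, ← Real.cos_pi]
    exact Real.cos_lt_cos_of_nonneg_of_le_pi (by positivity) le_rfl (by nlinarith)
  have hκ0 : κ ≤ 0 := Real.cos_nonpos_of_pi_div_two_le_of_le (by nlinarith) (by nlinarith)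
  refine ⟨Real.sqrt ((1 + κ) / 2), Real.sqrt_pos.2 (by linarith), fun p hp => ?_⟩
  set r := ‖p‖ ^ α with hr
  have hr0 : 0 ≤ r := by positivity
  have harg : |p.arg| < Real.pi / 2 := Complex.abs_arg_lt_pi_div_two_iff.2 (Or.inl hp)
  have hcos : κ ≤ Real.cos (p.arg * α) := by
    rw [← Real.cos_abs (p.arg * α), abs_mul, abs_of_pos (by linarith : 0 < α), hκ]
    refine Real.cos_le_cos_of_nonneg_of_le_pi (by positivity) (by nlinarith) (by nlinarith)
  have hre : (p ^ (α:ℂ)).re = r * Real.cos (p.arg * α) := by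
    rw [Complex.cpow_ofReal_re]
  have hn : ‖p ^ (α:ℂ)‖ = r := Complex.norm_cpow_real _ _
  have hsq : ‖p ^ (α:ℂ) + 1‖ ^ 2 = r ^ 2 + 2 * (r * Real.cos (p.arg * α)) + 1 := by
    rw [← hre, ← hn, ← Complex.normSq_eq_norm_sq, ← Complex.normSq_eq_norm_sq,
      Complex.normSq_apply, Complex.normSq_apply]
    simp; ring
  refine le_of_sq_le_sq ?_ (norm_nonneg _)
  rw [mul_pow, Real.sq_sqrt (by linarith), hsq]
  nlinarith [mul_le_mul_of_nonneg_left hcos hr0, sq_nonneg (1 - r),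
    mul_nonneg (by linarith : 0 ≤ -κ) (sq_nonneg (1-r)), mul_nonneg (by linarith : 0 ≤ 1 + κ) (sq_nonneg (1-r))]

lemma pt_ne1 (α : ℝ) (hα₁ : 1 < α) (hα₂ : α < 2) (p : ℂ) (hp : 0 < p.re) :
    p ^ (α:ℂ) + 1 ≠ 0 := by
  obtain ⟨δ, hδ, h⟩ := pt_lower α hα₁ hα₂
  have := h p hp
  rw [← norm_pos_iff]
  have : 0 ≤ ‖p‖ ^ α := by positivity
  nlinarith

lemma pt_Gbound (α β : ℝ) (hα₁ : 1 < α) (hα₂ : α < 2) (hβ : 0 < β) :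
    ∃ K ≥ (0:ℝ), ∀ p : ℂ, 0 < p.re → ∀ γ : ℝ, β + 1 - α ≤ γ → γ ≤ β + 1 →
      ‖ptG α β p‖ ≤ K * ‖p‖ ^ (-γ) := by
  obtain ⟨δ, hδ, hl⟩ := pt_lower α hα₁ hα₂
  refine ⟨β / δ + α / δ ^ 2, by positivity, fun p hp γ h1 h2 => ?_⟩
  have hp0 : p ≠ 0 := by rintro rfl; simp at hp
  have hr : 0 < ‖p‖ := norm_pos_iff.2 hp0
  set r := ‖p‖
  set D := ‖p ^ (α:ℂ) + 1‖ with hD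
  have hra : 0 < r ^ α := by positivity
  have hD1 : δ * (1 + r ^ α) ≤ D := hl p hp
  have hDp : 0 < D := lt_of_lt_of_le (by positivity) hD1
  have hn : ‖p ^ (α:ℂ)‖ = r ^ α := Complex.norm_cpow_real _ _
  have e1 : ‖ptG α β p‖ ≤ r ^ (-(β+1)) * (β * r ^ α / D + α * r ^ α / D ^ 2) := by
    rw [ptG, norm_mul, Complex.norm_cpow_real]
    refine mul_le_mul_of_nonneg_left ((norm_sub_le _ _).trans ?_) (by positivity)
    rw [norm_div, norm_div, norm_mul, norm_mul, hn, norm_pow, ← hD, Complex.norm_real,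
      Complex.norm_real, Real.norm_of_nonneg hβ.le, Real.norm_of_nonneg (by linarith)]
  refine e1.trans ?_
  have e2 : β * r ^ α / D ≤ β * r ^ α / (δ * (1 + r ^ α)) := by gcongr
  have e3 : α * r ^ α / D ^ 2 ≤ α * r ^ α / (δ ^ 2 * (1 + r ^ α)) := by
    apply div_le_div_of_nonneg_left (by positivity) (by positivity)
    calc δ ^ 2 * (1 + r ^ α) ≤ (δ * (1 + r ^ α)) ^ 2 := by
          rw [mul_pow]
          apply mul_le_mul_of_nonneg_left _ (by positivity)
          nlinarith
      _ ≤ D ^ 2 := by gcongr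
  have e4 : r ^ (-(β+1)) * r ^ α ≤ (1 + r ^ α) * r ^ (-γ) := by
    have : r ^ (-(β+1)) * r ^ α = r ^ (α - β - 1 + γ) * r ^ (-γ) := by
      rw [← Real.rpow_add hr, ← Real.rpow_add hr]; congr 1; ring
    rw [this]
    apply mul_le_mul_of_nonneg_right _ (by positivity)
    rcases le_total r 1 with h | h
    · have := Real.rpow_le_one hr.le h (by linarith : 0 ≤ α - β - 1 + γ)
      linarith
    · have := Real.rpow_le_rpow_of_exponent_le h (by linarith : α - β - 1 + γ ≤ α)
      linarith
  calc r ^ (-(β+1)) * (β * r ^ α / D + α * r ^ α / D ^ 2)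
      ≤ r ^ (-(β+1)) * (β * r ^ α / (δ * (1 + r ^ α)) + α * r ^ α / (δ ^ 2 * (1 + r ^ α))) := by
        gcongr
    _ = (β / δ + α / δ ^ 2) * ((r ^ (-(β+1)) * r ^ α) / (1 + r ^ α)) := by
        have : 1 + r ^ α ≠ 0 := by positivity
        field_simp
    _ ≤ (β / δ + α / δ ^ 2) * r ^ (-γ) := by
        apply mul_le_mul_of_nonneg_left _ (by positivity)
        rw [div_le_iff₀ (by positivity), mul_comm (r ^ (-γ))]
        exact e4

noncomputable def ptB (γ₁ γ₂ y : ℝ) : ℝ := min (|y| ^ (-γ₁)) (|y| ^ (-γ₂))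

lemma ptB_integ (γ₁ γ₂ : ℝ) (h1 : γ₁ < 1) (h2 : 1 < γ₂) : Integrable (ptB γ₁ γ₂) := by
  have hm : Measurable (ptB γ₁ γ₂) := by unfold ptB; fun_prop
  have hnn : ∀ y, 0 ≤ ptB γ₁ γ₂ y := fun y => le_min (by positivity) (by positivity)
  have hIoc : IntegrableOn (ptB γ₁ γ₂) (Set.Ioc 0 1) := by
    have : IntegrableOn (fun y : ℝ => y ^ (-γ₁)) (Set.Ioc 0 1) :=
      (intervalIntegrable_iff_integrableOn_Ioc_of_le zero_le_one).1
        (intervalIntegral.intervalIntegrable_rpow' (by linarith))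
    refine Integrable.mono' this hm.aestronglyMeasurable ?_
    refine (ae_restrict_iff' measurableSet_Ioc).2 (Filter.Eventually.of_forall fun t ht => ?_)
    rw [Real.norm_of_nonneg (hnn t)]
    refine (min_le_left _ _).trans ?_
    rw [abs_of_pos ht.1]
  have hIoi1 : IntegrableOn (ptB γ₁ γ₂) (Set.Ioi 1) := by
    have : IntegrableOn (fun y : ℝ => y ^ (-γ₂)) (Set.Ioi 1) :=
      integrableOn_Ioi_rpow_of_lt (by linarith) one_pos
    refine Integrable.mono' this hm.aestronglyMeasurable ?_
    refine (ae_restrict_iff' measurableSet_Ioi).2 (Filter.Eventually.of_forall fun t ht => ?_)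
    rw [Real.norm_of_nonneg (hnn t)]
    refine (min_le_right _ _).trans ?_
    rw [abs_of_pos (lt_trans one_pos ht)]
  have hIoi : IntegrableOn (ptB γ₁ γ₂) (Set.Ioi 0) := by
    rw [← Set.Ioc_union_Ioi_eq_Ioi (zero_le_one (α := ℝ))]
    exact hIoc.union hIoi1
  have hIio : IntegrableOn (ptB γ₁ γ₂) (Set.Iic 0) := by
    have : IntegrableOn (ptB γ₁ γ₂) (Set.Ici 0) := Iff.mpr integrableOn_Ici_iff_integrableOn_Ioi hIoi
    rw [← neg_zero (G := ℝ)] at this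
    have := this.comp_neg_Iic
    refine this.congr_fun (fun t _ => ?_) measurableSet_Iic
    simp [ptB]
  have := hIio.union hIoi
  rwa [Set.Iic_union_Ioi, integrableOn_univ] at this

lemma pt_shift (Φ : ℂ → ℂ) (c d M γ : ℝ) (hc : 0 < c) (hd : 0 < d) (hγ : 0 < γ)
    (hΦ : ∀ p : ℂ, 0 < p.re → DifferentiableAt ℂ Φ p)
    (hci : Integrable (fun y : ℝ => Φ (c + y * Complex.I)))
    (hdi : Integrable (fun y : ℝ => Φ (d + y * Complex.I)))
    (hM : ∀ x ∈ Set.uIcc c d, ∀ y : ℝ, y ≠ 0 → ‖Φ (x + y * Complex.I)‖ ≤ M * |y| ^ (-γ)) :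
    ∫ y : ℝ, Φ (d + y * Complex.I) = ∫ y : ℝ, Φ (c + y * Complex.I) := by
  have hrect : ∀ R : ℝ, (∫ x : ℝ in c..d, Φ (x + ((-R : ℝ) : ℂ) * Complex.I)) -
      (∫ x : ℝ in c..d, Φ (x + (R:ℂ) * Complex.I)) +
      Complex.I • (∫ y : ℝ in (-R)..R, Φ (d + y * Complex.I)) -
      Complex.I • (∫ y : ℝ in (-R)..R, Φ (c + y * Complex.I)) = 0 := by
    intro R
    have := Complex.integral_boundary_rect_eq_zero_of_differentiableOn Φ ⟨c, -R⟩ ⟨d, R⟩ (by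
      intro p hp
      refine (hΦ p ?_).differentiableWithinAt
      have := hp.1
      simp only [Set.mem_preimage] at this
      exact lt_of_lt_of_le (lt_min hc hd) this.1)
    exact this
  have hlim : ∀ σ : ℝ, |σ| = 1 → Filter.Tendsto
      (fun R : ℝ => ∫ x : ℝ in c..d, Φ (x + ((σ * R : ℝ) : ℂ) * Complex.I))
      Filter.atTop (nhds 0) := by
    intro σ hσ
    have h0 : Filter.Tendsto (fun R : ℝ => M * R ^ (-γ) * |d - c|) Filter.atTop (nhds 0) := by
      have := ((tendsto_rpow_neg_atTop hγ).const_mul M).mul_const |d - c|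
      simpa using this
    refine squeeze_zero_norm' ?_ h0
    filter_upwards [Filter.eventually_gt_atTop 0] with R hR
    refine intervalIntegral.norm_integral_le_of_norm_le_const (fun x hx => ?_)
    have hσ0 : σ ≠ 0 := by rintro rfl; simp at hσ
    have := hM x (Set.uIoc_subset_uIcc hx) (σ * R) (mul_ne_zero hσ0 hR.ne')
    rwa [abs_mul, hσ, one_mul, abs_of_pos hR] at this
  have l1 := hlim (-1) (by simp)
  have l2 := hlim 1 (by simp)
  simp only [neg_mul, one_mul] at l1 l2
  have l3 := (intervalIntegral_tendsto_integral hdi Filter.tendsto_neg_atTop_atBot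
    Filter.tendsto_id).const_smul Complex.I
  have l4 := (intervalIntegral_tendsto_integral hci Filter.tendsto_neg_atTop_atBot
    Filter.tendsto_id).const_smul Complex.I
  have l := ((l1.sub l2).add l3).sub l4
  have l0 := tendsto_nhds_unique (l.congr hrect) tendsto_const_nhds
  simp only [sub_zero, zero_add, smul_eq_mul] at l0
  exact mul_left_cancel₀ Complex.I_ne_zero (sub_eq_zero.1 l0)

noncomputable def ptΦ (α β s : ℝ) (p : ℂ) : ℂ := Complex.exp (p * s) * ptG α β p

lemma ptΦ_diff (α β s : ℝ) (hα₁ : 1 < α) (hα₂ : α < 2) (p : ℂ) (hp : 0 < p.re) :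
    DifferentiableAt ℂ (ptΦ α β s) p := by
  have hs : p ∈ Complex.slitPlane := Or.inl hp
  have h1 : ∀ e : ℂ, DifferentiableAt ℂ (fun p : ℂ => p ^ e) p :=
    fun e => differentiableAt_id.cpow_const hs
  have hne := pt_ne1 α hα₁ hα₂ p hp
  unfold ptΦ ptG
  refine DifferentiableAt.mul (by fun_prop) ((h1 _).mul (DifferentiableAt.sub ?_ ?_))
  · exact ((h1 _).const_mul _).div ((h1 _).add_const _) hne
  · exact ((h1 _).const_mul _).div (((h1 _).add_const _).pow 2) (pow_ne_zero 2 hne)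

lemma pt_hasSum (α β s : ℝ) (hα₁ : 1 < α) (hα₂ : α < 2) (hβ : 0 < β) (hs : 0 < s) :
    HasSum (fun k : ℕ => ((2 * Real.pi * ((-1) ^ k * s ^ (α * k + β) / Real.Gamma (α * k + β)) : ℝ) : ℂ))
      (∫ y : ℝ, ptΦ α β s ((2:ℝ) + y * Complex.I)) := by
  set F : ℕ → ℝ → ℂ := fun k y => ((-1) ^ k * ((α * k + β : ℝ) : ℂ)) *
    (Complex.exp (((2:ℂ) + y * Complex.I) * s) *
      ((2:ℂ) + y * Complex.I) ^ ((-((α * k + β)+1) : ℝ) : ℂ)) with hF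
  have ha : ∀ k : ℕ, 0 < α * k + β := fun k => by positivity
  have hexpn : ∀ y : ℝ, ‖Complex.exp (((2:ℂ) + y * Complex.I) * s)‖ = Real.exp (2 * s) := by
    intro y; rw [Complex.norm_exp]; simp
  have hFint : ∀ k, Integrable (F k) := by
    intro k
    refine Integrable.const_mul ?_ _
    refine (pt_vert_integ ((α * k + β)+1) (by linarith [ha k])).bdd_mul
      (c := Real.exp (2 * s)) (Continuous.aestronglyMeasurable (by fun_prop)) ?_
    exact Filter.Eventually.of_forall fun y => (hexpn y).le
  have hval : ∀ k, ∫ y, F k y = ((2 * Real.pi * ((-1) ^ k * s ^ (α * k + β) / Real.Gamma (α * k + β)) : ℝ) : ℂ) := by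
    intro k
    simp only [hF]
    rw [integral_const_mul, pt_invGamma _ s (ha k) hs, Real.Gamma_add_one (ha k).ne']
    have h1 : Real.Gamma (α * k + β) ≠ 0 := (Real.Gamma_pos_of_pos (ha k)).ne'
    have h2 := (ha k).ne'
    have : ((-1 : ℝ)) ^ k * (α * k + β) * (2 * Real.pi * (s ^ (α * k + β) /
      ((α * k + β) * Real.Gamma (α * k + β)))) =
      2 * Real.pi * ((-1) ^ k * s ^ (α * k + β) / Real.Gamma (α * k + β)) := by
      field_simp
    rw [← this]; push_cast; ring
  have hpnorm : ∀ y : ℝ, 2 ≤ ‖(2:ℂ) + y * Complex.I‖ := by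
    intro y
    refine le_of_sq_le_sq ?_ (norm_nonneg _)
    rw [pt_normc]; nlinarith [sq_nonneg y]
  set q : ℝ := (2:ℝ) ^ (-α) with hq
  have hq0 : 0 < q := by positivity
  have hq1 : q < 1 := Real.rpow_lt_one_of_one_lt_of_neg one_lt_two (by linarith)
  set J := ∫ y : ℝ, (1 + ‖y‖ ^ 2) ^ (-(β+1)/2) with hJ
  have hFn : ∀ k y, ‖F k y‖ ≤ ((α * k + β) * q ^ k * Real.exp (2 * s)) * (1 + ‖y‖ ^ 2) ^ (-(β+1)/2) := by
    intro k y
    have hp0 := lt_of_lt_of_le two_pos (hpnorm y)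
    simp only [hF]
    rw [norm_mul, norm_mul, norm_mul, hexpn, norm_pow, norm_neg, norm_one, one_pow, one_mul,
      Complex.norm_real, Real.norm_of_nonneg (ha k).le, Complex.norm_cpow_real]
    have e : ‖(2:ℂ) + y * Complex.I‖ ^ (-((α * k + β)+1)) =
      (‖(2:ℂ) + y * Complex.I‖ ^ (-α)) ^ k * ‖(2:ℂ) + y * Complex.I‖ ^ (-(β+1)) := by
      rw [← Real.rpow_natCast, ← Real.rpow_mul hp0.le, ← Real.rpow_add hp0]; congr 1; ring
    rw [e]
    have e1 : ‖(2:ℂ) + y * Complex.I‖ ^ (-α) ≤ q :=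
      Real.rpow_le_rpow_of_nonpos two_pos (hpnorm y) (by linarith)
    have e2 := pt_vert_le (β+1) y (by linarith)
    rw [Complex.norm_cpow_real] at e2
    calc (α * k + β) * (Real.exp (2 * s) * ((‖(2:ℂ) + y * Complex.I‖ ^ (-α)) ^ k * ‖(2:ℂ) + y * Complex.I‖ ^ (-(β+1))))
        ≤ (α * k + β) * (Real.exp (2 * s) * (q ^ k * (1 + ‖y‖ ^ 2) ^ (-(β+1)/2))) := by
          have := ha k
          gcongr
      _ = _ := by ring
  have hsum : Summable (fun k => ∫ y, ‖F k y‖) := by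
    have hs1 : Summable (fun k : ℕ => ((α * k + β) * q ^ k * Real.exp (2 * s)) * J) := by
      have h1 : Summable (fun k : ℕ => (k:ℝ) ^ 1 * q ^ k) :=
        summable_pow_mul_geometric_of_norm_lt_one 1 (by rwa [Real.norm_of_nonneg hq0.le])
      have h2 : Summable (fun k : ℕ => q ^ k) := summable_geometric_of_lt_one hq0.le hq1
      refine (((h1.mul_left α).add (h2.mul_left β)).mul_right (Real.exp (2 * s) * J)).congr ?_
      intro k; ring
    refine Summable.of_nonneg_of_le (fun k => integral_nonneg fun y => norm_nonneg _) (fun k => ?_) hs1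
    rw [hJ, ← integral_const_mul]
    exact integral_mono (hFint k).norm ((pt_jap (β+1) (by linarith)).const_mul _) (hFn k)
  have main := hasSum_integral_of_summable_integral_norm hFint hsum
  simp only [hval] at main
  suffices hpt : ∀ y : ℝ, HasSum (fun k => F k y) (ptΦ α β s ((2:ℝ) + y * Complex.I)) by
    have e : (fun y : ℝ => ∑' k, F k y) = fun y : ℝ => ptΦ α β s ((2:ℝ) + y * Complex.I) :=
      funext fun y => (hpt y).tsum_eq
    rw [← e]
    exact main
  intro y
  set p : ℂ := (2:ℂ) + y * Complex.I with hp
  have hp0 : p ≠ 0 := pt_ne y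
  have hpre : 0 < p.re := by simp [hp]
  have hne := pt_ne1 α hα₁ hα₂ p hpre
  have hpa : p ^ (α:ℂ) ≠ 0 := by simp [Complex.cpow_eq_zero_iff, hp0]
  set w : ℂ := - (p ^ (α:ℂ))⁻¹ with hw
  have hwn : ‖w‖ < 1 := by
    rw [hw, norm_neg, norm_inv, Complex.norm_cpow_real, ← Real.rpow_neg (norm_nonneg _)]
    exact lt_of_le_of_lt (Real.rpow_le_rpow_of_nonpos two_pos (hpnorm y) (by linarith)) hq1
  have g1 := (hasSum_coe_mul_geometric_of_norm_lt_one hwn).mul_left (α:ℂ)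
  have g2 := (hasSum_geometric_of_norm_lt_one hwn).mul_left (β:ℂ)
  have g := (g1.add g2).mul_left (Complex.exp (p * s) * p ^ ((-(β+1) : ℝ) : ℂ))
  suffices e12 : (fun k => F k y) = (fun i : ℕ => Complex.exp (p * s) * p ^ ((-(β+1) : ℝ) : ℂ) *
      (α * (i * w ^ i) + β * w ^ i)) ∧ ptΦ α β s ((2:ℝ) + y * Complex.I) =
      Complex.exp (p * s) * p ^ ((-(β+1) : ℝ) : ℂ) *
        (α * (w / (1 - w) ^ 2) + β * (1 - w)⁻¹) by
    rw [e12.1, e12.2]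
    exact g
  constructor
  · ext k
    simp only [hF]
    have : p ^ ((-((α * k + β)+1) : ℝ) : ℂ) = ((p ^ (α:ℂ))⁻¹) ^ k * p ^ ((-(β+1) : ℝ) : ℂ) := by
      rw [← Complex.cpow_neg, ← Complex.cpow_nat_mul, ← Complex.cpow_add _ _ hp0]
      congr 1; push_cast; ring
    rw [this, hw, neg_pow]
    push_cast; ring
  · rw [ptΦ, ptG]
    have hcast : ((2:ℝ):ℂ) + y * Complex.I = p := by simp [hp]
    rw [hcast, mul_assoc (Complex.exp (p * s))]
    congr 2
    have h1w : 1 - w = (p ^ (α:ℂ) + 1) / p ^ (α:ℂ) := by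
      rw [hw]; field_simp
      ring
    rw [h1w, hw]
    field_simp
    ring

lemma pt_vertbound (α β : ℝ) (hα₁ : 1 < α) (hα₂ : α < 2) (hβ : 0 < β) (hβα : β < α) :
    ∃ C : ℝ, ∀ s : ℝ, 0 < s →
      ‖∫ y : ℝ, ptΦ α β s ((2:ℝ) + y * Complex.I)‖ ≤ C := by
  obtain ⟨K, hK, hG⟩ := pt_Gbound α β hα₁ hα₂ hβ
  set γ₁ := max 0 (β + 1 - α) with hγ₁
  have hγ₁0 : 0 ≤ γ₁ := le_max_left _ _
  have hγ₁1 : γ₁ < 1 := max_lt one_pos (by linarith)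
  have hγ₁a : β + 1 - α ≤ γ₁ := le_max_right _ _
  have hγ₁b : γ₁ ≤ β + 1 := by linarith
  have hpow : ∀ c y : ℝ, y ≠ 0 → ∀ γ : ℝ, 0 ≤ γ →
      ‖(c:ℂ) + y * Complex.I‖ ^ (-γ) ≤ |y| ^ (-γ) := by
    intro c y hy γ hγ
    refine Real.rpow_le_rpow_of_nonpos (abs_pos.2 hy) ?_ (by linarith)
    have := Complex.abs_im_le_norm ((c:ℂ) + y * Complex.I)
    simpa using this
  have hb : ∀ s c : ℝ, 0 < c → ∀ y : ℝ, y ≠ 0 → ∀ γ, 0 ≤ γ → β + 1 - α ≤ γ → γ ≤ β + 1 →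
      ‖ptΦ α β s (c + y * Complex.I)‖ ≤ Real.exp (c * s) * K * |y| ^ (-γ) := by
    intro s c hc y hy γ h0 h1 h2
    rw [ptΦ, norm_mul, Complex.norm_exp, mul_assoc]
    have : (((c:ℂ) + y * Complex.I) * s).re = c * s := by simp
    rw [this]
    refine mul_le_mul_of_nonneg_left ((hG _ (by simpa using hc) γ h1 h2).trans ?_) (Real.exp_nonneg _)
    exact mul_le_mul_of_nonneg_left (hpow c y hy γ h0) hK
  have hbB : ∀ s c : ℝ, 0 < c → ∀ᵐ y : ℝ,
      ‖ptΦ α β s (c + y * Complex.I)‖ ≤ Real.exp (c * s) * K * ptB γ₁ (β+1) y := by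
    intro s c hc
    filter_upwards [Measure.ae_ne volume (0:ℝ)] with y hy
    rw [ptB, mul_min_of_nonneg _ _ (by positivity)]
    exact le_min (hb s c hc y hy _ hγ₁0 hγ₁a hγ₁b) (hb s c hc y hy _ (by linarith) (by linarith) le_rfl)
  have hBi : Integrable (ptB γ₁ (β+1)) := ptB_integ _ _ hγ₁1 (by linarith)
  have hint : ∀ s c : ℝ, 0 < c → Integrable (fun y : ℝ => ptΦ α β s (c + y * Complex.I)) := by
    intro s c hc
    refine (hBi.const_mul _).mono' ?_ (hbB s c hc)
    refine Continuous.aestronglyMeasurable (continuous_iff_continuousAt.2 fun y => ?_)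
    have h1 := (ptΦ_diff α β s hα₁ hα₂ (c + y * Complex.I) (by simpa using hc)).continuousAt
    exact ContinuousAt.comp (f := fun y : ℝ => (c:ℂ) + y * Complex.I) h1 (by fun_prop)
  refine ⟨Real.exp 1 * K * ∫ y, ptB γ₁ (β+1) y, fun s hs => ?_⟩
  have hc : 0 < 1 / s := by positivity
  rw [pt_shift (ptΦ α β s) (1/s) 2 (Real.exp (max (1/s) 2 * s) * K) (β+1) hc two_pos (by linarith)
    (ptΦ_diff α β s hα₁ hα₂) (hint s _ hc) (hint s _ two_pos) ?_]
  · have h := norm_integral_le_of_norm_le (hBi.const_mul (Real.exp (1 / s * s) * K)) (hbB s (1/s) hc)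
    rwa [integral_const_mul, one_div_mul_cancel hs.ne'] at h
  · intro x hx y hy
    have hx0 : 0 < x := lt_of_lt_of_le (lt_min hc two_pos) hx.1
    have hx1 : x ≤ max (1/s) 2 := hx.2
    refine (hb s x hx0 y hy (β+1) (by linarith) (by linarith) le_rfl).trans ?_
    gcongr

lemma pt_term (α β x : ℝ) (hα : 1 < α) (hx : 0 < x) (k : ℕ) :
    (-1) ^ k * (x ^ (1/α)) ^ (α * k + β) / Real.Gamma (α * k + β) =
      x ^ (β/α) * ((-x) ^ k / Real.Gamma (α * k + β)) := by
  have : (x ^ (1/α)) ^ (α * k + β) = x ^ (β/α) * x ^ k := by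
    rw [← Real.rpow_natCast x k, ← Real.rpow_mul hx.le, ← Real.rpow_add hx]
    congr 1; field_simp; ring
  rw [this, neg_pow x k]; ring

lemma pt_summ (α β x : ℝ) (hα₁ : 1 < α) (hα₂ : α < 2) (hβ : 0 < β) (hx : 0 < x) :
    Summable (fun k : ℕ => (-x) ^ k / Real.Gamma (α * k + β)) := by
  have h := (pt_hasSum α β (x ^ (1/α)) hα₁ hα₂ hβ (by positivity)).summable
  have h := Complex.summable_ofReal.1 h
  refine (h.mul_left ((2 * Real.pi * x ^ (β/α))⁻¹)).congr fun k => ?_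
  rw [pt_term α β x hα₁ hx]
  have : x ^ (β/α) ≠ 0 := by positivity
  have := Real.pi_ne_zero
  field_simp

lemma pt_decay (α β : ℝ) (hα₁ : 1 < α) (hα₂ : α < 2) (hβ : 0 < β) (hβα : β < α) :
    ∃ C : ℝ, ∀ x : ℝ, 0 < x → x ^ (β/α) * |mittagLeffler α β (-x)| ≤ C := by
  obtain ⟨C, hC⟩ := pt_vertbound α β hα₁ hα₂ hβ hβα
  refine ⟨C / (2 * Real.pi), fun x hx => ?_⟩
  have h := pt_hasSum α β (x ^ (1/α)) hα₁ hα₂ hβ (by positivity)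
  have h2 := hC (x ^ (1/α)) (by positivity)
  have hpi := Real.pi_pos
  rw [← h.tsum_eq, ← Complex.ofReal_tsum, Complex.norm_real, Real.norm_eq_abs] at h2
  simp_rw [pt_term α β x hα₁ hx] at h2
  rw [tsum_mul_left, tsum_mul_left, abs_mul,
    abs_of_pos (by positivity : 0 < 2 * Real.pi), abs_mul,
    abs_of_pos (by positivity : 0 < x ^ (β/α))] at h2
  rw [le_div_iff₀ (by positivity), mul_comm]
  exact h2

lemma pt_small (α β : ℝ) (hα₁ : 1 < α) (hα₂ : α < 2) (hβ : 0 < β) :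
    ∃ C : ℝ, ∀ x : ℝ, 0 < x → x ≤ 1 → |mittagLeffler α β (-x)| ≤ C := by
  have h1 := (pt_summ α β 1 hα₁ hα₂ hβ one_pos).abs
  refine ⟨∑' k : ℕ, |(-1) ^ k / Real.Gamma (α * k + β)|, fun x hx hx1 => ?_⟩
  · have h := pt_summ α β x hα₁ hα₂ hβ hx
    unfold mittagLeffler
    rw [← Real.norm_eq_abs]
    refine tsum_of_norm_bounded h1.hasSum fun k => ?_
    rw [Real.norm_eq_abs, abs_div, abs_div, abs_pow, abs_pow, abs_neg, abs_neg, abs_one, one_pow,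
      abs_of_pos hx]
    gcongr
    exact pow_le_one₀ hx.le hx1

lemma pt_rec (α x : ℝ) (hα₁ : 1 < α) (hα₂ : α < 2) (hx : 0 < x) :
    x * mittagLeffler α 2 (-x) = 1 / Real.Gamma (2 - α) - mittagLeffler α (2 - α) (-x) := by
  have h := pt_summ α (2 - α) x hα₁ hα₂ (by linarith) hx
  unfold mittagLeffler
  rw [h.tsum_eq_zero_add]
  have : ∀ k : ℕ, (-x) ^ (k+1) / Real.Gamma (α * ((k+1 : ℕ):ℝ) + (2 - α)) =
      -x * ((-x) ^ k / Real.Gamma (α * k + 2)) := by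
    intro k
    rw [show α * ((k+1 : ℕ):ℝ) + (2 - α) = α * k + 2 by push_cast; ring]
    ring
  simp_rw [this]
  rw [tsum_mul_left]; simp

lemma pt_E1 (α θ : ℝ) (hα₁ : 1 < α) (hα₂ : α < 2) (hθ₀ : 0 < θ) (hθ₁ : θ < 1 / (2 * α)) :
    ∃ C : ℝ, ∀ x : ℝ, 0 < x → x ^ θ * |mittagLeffler α 1 (-x)| ≤ C := by
  obtain ⟨C1, h1⟩ := pt_small α 1 hα₁ hα₂ one_pos
  obtain ⟨C2, h2⟩ := pt_decay α 1 hα₁ hα₂ one_pos hα₁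
  refine ⟨max C1 C2, fun x hx => ?_⟩
  rcases le_total x 1 with h | h
  · refine le_trans ?_ ((h1 x hx h).trans (le_max_left _ _))
    exact mul_le_of_le_one_left (abs_nonneg _) (Real.rpow_le_one hx.le h hθ₀.le)
  · refine le_trans ?_ ((h2 x hx).trans (le_max_right _ _))
    refine mul_le_mul_of_nonneg_right (Real.rpow_le_rpow_of_exponent_le h ?_) (abs_nonneg _)
    refine hθ₁.le.trans ?_
    exact one_div_le_one_div_of_le (by linarith) (by linarith)

lemma pt_E2 (α θ : ℝ) (hα₁ : 1 < α) (hα₂ : α < 2) (hθ₀ : 0 < θ) (hθ₁ : θ < 1 / (2 * α)) :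
    ∃ C : ℝ, ∀ x : ℝ, 0 < x → x ^ (1/2 + θ) * |mittagLeffler α 2 (-x)| ≤ C := by
  obtain ⟨C1, h1⟩ := pt_small α 2 hα₁ hα₂ two_pos
  obtain ⟨C2, h2⟩ := pt_decay α (2 - α) hα₁ hα₂ (by linarith) (by linarith)
  have hθ2 : θ ≤ 1/2 := hθ₁.le.trans (one_div_le_one_div_of_le (by norm_num) (by linarith))
  refine ⟨max C1 (|1 / Real.Gamma (2 - α)| + C2), fun x hx => ?_⟩
  rcases le_total x 1 with h | h
  · refine le_trans ?_ ((h1 x hx h).trans (le_max_left _ _))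
    exact mul_le_of_le_one_left (abs_nonneg _) (Real.rpow_le_one hx.le h (by linarith))
  · refine le_trans ?_ (le_max_right _ _)
    have e1 : x ^ (1/2 + θ) ≤ x := by
      simpa using Real.rpow_le_rpow_of_exponent_le h (by linarith : 1/2 + θ ≤ 1)
    have e2 : |mittagLeffler α (2 - α) (-x)| ≤ C2 := by
      refine le_trans ?_ (h2 x hx)
      exact le_mul_of_one_le_left (abs_nonneg _)
        (Real.one_le_rpow h (div_nonneg (by linarith) (by linarith)))
    calc x ^ (1/2 + θ) * |mittagLeffler α 2 (-x)| ≤ x * |mittagLeffler α 2 (-x)| := by gcongr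
      _ = |x * mittagLeffler α 2 (-x)| := by rw [abs_mul, abs_of_pos hx]
      _ = |1 / Real.Gamma (2 - α) - mittagLeffler α (2 - α) (-x)| := by rw [pt_rec α x hα₁ hα₂ hx]
      _ ≤ _ := (abs_sub _ _).trans (by linarith)

lemma pt_pointwise (α θ : ℝ) (hα₁ : 1 < α) (hα₂ : α < 2)
    (hθ₀ : 0 < θ) (hθ₁ : θ < 1 / (2 * α)) :
    ∃ C > (0 : ℝ), ∀ l a b t : ℝ, 0 < l → 0 < t →
      l ^ ((3 : ℝ) / 2 + 2 * θ) * (a * mittagLeffler α 1 (-l * t ^ α) +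
              b * t * mittagLeffler α 2 (-l * t ^ α)) ^ 2 ≤
      C * t ^ (-(2 * α * θ)) * (l ^ ((3 : ℝ) / 2) * a ^ 2) +
        C * t ^ (2 - α * (1 + 2 * θ)) * (l ^ ((1 : ℝ) / 2) * b ^ 2) := by
  obtain ⟨C1, h1⟩ := pt_E1 α θ hα₁ hα₂ hθ₀ hθ₁
  obtain ⟨C2, h2⟩ := pt_E2 α θ hα₁ hα₂ hθ₀ hθ₁
  refine ⟨2 * (C1 ^ 2 + C2 ^ 2 + 1), by positivity, fun l a b t hl ht => ?_⟩
  have hx : 0 < l * t ^ α := by positivity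
  rw [neg_mul]
  set x := l * t ^ α with hxd
  set E1 := mittagLeffler α 1 (-x)
  set E2 := mittagLeffler α 2 (-x)
  have i1 : (x ^ θ) ^ 2 * E1 ^ 2 ≤ C1 ^ 2 + C2 ^ 2 + 1 := by
    have : (x ^ θ * |E1|) ^ 2 ≤ C1 ^ 2 := pow_le_pow_left₀ (by positivity) (h1 x hx) 2
    rw [mul_pow, sq_abs] at this
    nlinarith [sq_nonneg C2]
  have i2 : (x ^ (1/2 + θ)) ^ 2 * E2 ^ 2 ≤ C1 ^ 2 + C2 ^ 2 + 1 := by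
    have : (x ^ (1/2 + θ) * |E2|) ^ 2 ≤ C2 ^ 2 := pow_le_pow_left₀ (by positivity) (h2 x hx) 2
    rw [mul_pow, sq_abs] at this
    nlinarith [sq_nonneg C1]
  have xp : ∀ e : ℝ, (x ^ e) ^ 2 = l ^ (2 * e) * t ^ (2 * α * e) := by
    intro e
    rw [hxd, Real.mul_rpow hl.le (by positivity), mul_pow, ← Real.rpow_natCast, ← Real.rpow_natCast,
      ← Real.rpow_mul hl.le, ← Real.rpow_mul ht.le, ← Real.rpow_mul ht.le]
    congr 2 <;> push_cast <;> ring
  have j1 : l ^ ((3 : ℝ) / 2 + 2 * θ) = t ^ (-(2 * α * θ)) * l ^ ((3 : ℝ) / 2) * (x ^ θ) ^ 2 := by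
    rw [xp, Real.rpow_add hl, Real.rpow_neg ht.le]
    have : t ^ (2 * α * θ) ≠ 0 := by positivity
    field_simp
  have j2 : l ^ ((3 : ℝ) / 2 + 2 * θ) * t ^ 2 =
      t ^ (2 - α * (1 + 2 * θ)) * l ^ ((1 : ℝ) / 2) * (x ^ (1/2 + θ)) ^ 2 := by
    rw [xp, show (3 : ℝ) / 2 + 2 * θ = 1/2 + 2 * (1/2 + θ) by ring, Real.rpow_add hl,
      show 2 - α * (1 + 2 * θ) = 2 - 2 * α * (1/2 + θ) by ring, Real.rpow_sub ht]
    have : t ^ (2 * α * (1/2 + θ)) ≠ 0 := by positivity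
    rw [show t ^ (2:ℝ) = t ^ 2 by exact_mod_cast Real.rpow_natCast t 2]
    field_simp
  have hL : 0 ≤ l ^ ((3 : ℝ) / 2 + 2 * θ) := by positivity
  calc l ^ ((3 : ℝ) / 2 + 2 * θ) * (a * E1 + b * t * E2) ^ 2
      ≤ l ^ ((3 : ℝ) / 2 + 2 * θ) * (2 * (a ^ 2 * E1 ^ 2 + b ^ 2 * t ^ 2 * E2 ^ 2)) := by
        apply mul_le_mul_of_nonneg_left _ hL
        nlinarith [sq_nonneg (a * E1 - b * t * E2)]
    _ = 2 * (l ^ ((3 : ℝ) / 2 + 2 * θ) * a ^ 2 * E1 ^ 2) +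
          2 * ((l ^ ((3 : ℝ) / 2 + 2 * θ) * t ^ 2) * b ^ 2 * E2 ^ 2) := by ring
    _ = 2 * (t ^ (-(2 * α * θ)) * (l ^ ((3 : ℝ) / 2) * a ^ 2)) * ((x ^ θ) ^ 2 * E1 ^ 2) +
        2 * (t ^ (2 - α * (1 + 2 * θ)) * (l ^ ((1 : ℝ) / 2) * b ^ 2)) *
          ((x ^ (1/2 + θ)) ^ 2 * E2 ^ 2) := by
        rw [j2, j1]; ring
    _ ≤ 2 * (t ^ (-(2 * α * θ)) * (l ^ ((3 : ℝ) / 2) * a ^ 2)) * (C1 ^ 2 + C2 ^ 2 + 1) +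
        2 * (t ^ (2 - α * (1 + 2 * θ)) * (l ^ ((1 : ℝ) / 2) * b ^ 2)) * (C1 ^ 2 + C2 ^ 2 + 1) := by
        gcongr
    _ = _ := by ring

lemma pt_lint (C e T : ℝ) (he : -1 < e) (hT : 0 < T) :
    ∫⁻ t in Set.Ioo (0:ℝ) T, ENNReal.ofReal (C * t ^ e) < ⊤ := by
  have h : IntegrableOn (fun t : ℝ => C * t ^ e) (Set.Ioo 0 T) := by
    have : IntegrableOn (fun y : ℝ => y ^ e) (Set.Ioc 0 T) :=
      (intervalIntegrable_iff_integrableOn_Ioc_of_le hT.le).1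
        (intervalIntegral.intervalIntegrable_rpow' he)
    exact (this.mono_set Set.Ioo_subset_Ioc_self).const_mul C
  exact h.lintegral_lt_top


/-- For `α ∈ (1,2)` and `θ ∈ (0, 1/(2α))` there is `C > 0` depending only on `α` and `θ`
such that for all positive `λ_n`, all real `a_n, b_n` and all `t > 0` (sums in `[0,∞]`):
`∑ λ_n^{3/2+2θ} |a_n E_α(-λ_n t^α) + b_n t E_{α,2}(-λ_n t^α)|²
  ≤ C t^{-2αθ} ∑ λ_n^{3/2} a_n² + C t^{2-α(1+2θ)} ∑ λ_n^{1/2} b_n²`;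
consequently (when the right-hand sums are finite) the left-hand side has finite integral
over `(0,T)` for every `T > 0`. This yields `∇Δu ∈ L²(0,T; D(A^θ))`. -/
theorem petrovsky_DAtheta_bound (α θ : ℝ) (hα₁ : 1 < α) (hα₂ : α < 2)
    (hθ₀ : 0 < θ) (hθ₁ : θ < 1 / (2 * α)) :
    ∃ C > (0 : ℝ), ∀ lam a b : ℕ → ℝ, (∀ n, 0 < lam n) →
      (∀ t : ℝ, 0 < t →
        (∑' n, ENNReal.ofReal ((lam n) ^ ((3 : ℝ) / 2 + 2 * θ) *
            (a n * mittagLeffler α 1 (-(lam n) * t ^ α) +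
              b n * t * mittagLeffler α 2 (-(lam n) * t ^ α)) ^ 2)) ≤
          ENNReal.ofReal (C * t ^ (-(2 * α * θ))) *
              (∑' n, ENNReal.ofReal ((lam n) ^ ((3 : ℝ) / 2) * (a n) ^ 2)) +
            ENNReal.ofReal (C * t ^ (2 - α * (1 + 2 * θ))) *
              (∑' n, ENNReal.ofReal ((lam n) ^ ((1 : ℝ) / 2) * (b n) ^ 2))) ∧
      ((Summable fun n => (lam n) ^ ((3 : ℝ) / 2) * (a n) ^ 2) →
        (Summable fun n => (lam n) ^ ((1 : ℝ) / 2) * (b n) ^ 2) →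
        ∀ T : ℝ, 0 < T →
          (∫⁻ t in Set.Ioo (0 : ℝ) T,
            ∑' n, ENNReal.ofReal ((lam n) ^ ((3 : ℝ) / 2 + 2 * θ) *
              (a n * mittagLeffler α 1 (-(lam n) * t ^ α) +
                b n * t * mittagLeffler α 2 (-(lam n) * t ^ α)) ^ 2)) < ⊤) := by
  obtain ⟨C, hC, hb⟩ := pt_pointwise α θ hα₁ hα₂ hθ₀ hθ₁
  refine ⟨C, hC, fun lam a b hl => ?_⟩
  have first : ∀ t : ℝ, 0 < t →
        (∑' n, ENNReal.ofReal ((lam n) ^ ((3 : ℝ) / 2 + 2 * θ) *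
            (a n * mittagLeffler α 1 (-(lam n) * t ^ α) +
              b n * t * mittagLeffler α 2 (-(lam n) * t ^ α)) ^ 2)) ≤
          ENNReal.ofReal (C * t ^ (-(2 * α * θ))) *
              (∑' n, ENNReal.ofReal ((lam n) ^ ((3 : ℝ) / 2) * (a n) ^ 2)) +
            ENNReal.ofReal (C * t ^ (2 - α * (1 + 2 * θ))) *
              (∑' n, ENNReal.ofReal ((lam n) ^ ((1 : ℝ) / 2) * (b n) ^ 2)) := by
    intro t ht
    rw [← ENNReal.tsum_mul_left, ← ENNReal.tsum_mul_left, ← ENNReal.tsum_add]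
    refine ENNReal.tsum_le_tsum fun n => ?_
    have hn := hl n
    rw [← ENNReal.ofReal_mul (by positivity), ← ENNReal.ofReal_mul (by positivity),
      ← ENNReal.ofReal_add (by positivity) (by positivity)]
    exact ENNReal.ofReal_le_ofReal (hb (lam n) (a n) (b n) t hn ht)
  refine ⟨first, fun hA hB T hT => ?_⟩
  have hαθ : 2 * α * θ < 1 := by
    rw [lt_div_iff₀ (by linarith)] at hθ₁
    linarith
  refine lt_of_le_of_lt (setLIntegral_mono' measurableSet_Ioo fun t ht => first t ht.1) ?_
  rw [lintegral_add_left (by fun_prop), lintegral_mul_const _ (by fun_prop),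
    lintegral_mul_const _ (by fun_prop)]
  refine ENNReal.add_lt_top.2 ⟨ENNReal.mul_lt_top (pt_lint _ _ _ (by linarith) hT) ?_,
    ENNReal.mul_lt_top (pt_lint _ _ _ (by nlinarith) hT) ?_⟩
  · exact hA.tsum_ofReal_lt_top
  · exact hB.tsum_ofReal_lt_top
end

section
/- Let α ∈ (1,2). There exists C > 0, depending only on α, such that for every T > 0, every sequence (λ_n) of positive reals, and all real sequences (a_n), (b_n) with ∑_n λ_n a_n² < ∞ and ∑_n b_n² < ∞: ∫_0^T ( ∑_n λ_n | a_n t^{α−2} E_{α,α−1}(−λ_n t^α) + b_n t^{α−1} E_{α,α}(−λ_n t^α) |² )^{1/2} dt ≤ C ( T^{α−1} ( ∑_n λ_n a_n² )^{1/2} + T^{α/2} ( ∑_n b_n² )^{1/2} ). (This is the L¹(0,T;L²(Ω)) bound on the termwise time derivative series showing that w_t is absolutely continuous in the proof that A^{−1/2}u is a strong solution.) -/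
open MeasureTheory

lemma ML_beta_ii (u v : ℝ) (hu : 0 < u) (hv : 0 < v) :
    IntervalIntegrable (fun x : ℝ => x ^ (u - 1) * (1 - x) ^ (v - 1)) volume 0 1 ∧
    (∫ x in (0:ℝ)..1, x ^ (u - 1) * (1 - x) ^ (v - 1)) =
      Real.Gamma u * Real.Gamma v / Real.Gamma (u + v) := by
  have hc := Complex.betaIntegral_convergent (u := (u:ℂ)) (v := (v:ℂ)) (by simpa) (by simpa)
  have heq : ∀ x ∈ Set.Ioc (0:ℝ) 1, ((x:ℂ) ^ ((u:ℂ) - 1) * (1 - (x:ℂ)) ^ ((v:ℂ) - 1)) =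
      ((x ^ (u - 1) * (1 - x) ^ (v - 1) : ℝ) : ℂ) := by
    intro x hx
    push_cast
    rw [Complex.ofReal_cpow hx.1.le, Complex.ofReal_cpow (by linarith [hx.2])]
    push_cast
    rfl
  have hb : ProbabilityTheory.beta u v = (Complex.betaIntegral u v).re :=
    ProbabilityTheory.beta_eq_betaIntegralReal u v hu hv
  have h1 : Complex.betaIntegral u v
      = ((∫ x in (0:ℝ)..1, x ^ (u - 1) * (1 - x) ^ (v - 1) : ℝ) : ℂ) := by
    rw [Complex.betaIntegral, ← intervalIntegral.integral_ofReal]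
    rw [intervalIntegral.integral_of_le zero_le_one, intervalIntegral.integral_of_le zero_le_one]
    exact setIntegral_congr_fun measurableSet_Ioc heq
  constructor
  · rw [intervalIntegrable_iff_integrableOn_Ioc_of_le zero_le_one] at hc ⊢
    have := (hc.congr_fun heq measurableSet_Ioc).re
    simpa [IntegrableOn] using this
  · rw [h1] at hb
    simp only [Complex.ofReal_re] at hb
    rw [← hb, ProbabilityTheory.beta]

lemma ML_bern (γ : ℝ) (h0 : 0 < γ) (h1 : γ < 1) (k : ℕ) (x : ℝ) (hx0 : 0 < x) (hx1 : x ≤ 1) :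
    0 ≤ 1 - x ^ (γ * k) ∧ 1 - x ^ (γ * k) ≤ k * (1 - x) := by
  constructor
  · have := Real.rpow_le_one hx0.le hx1 (by positivity : 0 ≤ γ * k)
    linarith
  · have h2 : x ^ (k : ℝ) ≤ x ^ (γ * k) := by
      apply Real.rpow_le_rpow_of_exponent_ge hx0 hx1
      have : (0:ℝ) ≤ k := by positivity
      nlinarith
    rw [Real.rpow_natCast] at h2
    have h3 := one_add_mul_le_pow (a := x - 1) (by linarith) k
    have : 1 + (x - 1) = x := by ring
    rw [this] at h3
    nlinarith

lemma ML_int (γ : ℝ) (h0 : 0 < γ) (h1 : γ < 1) (k : ℕ) :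
    IntegrableOn (fun x : ℝ => (1 - x ^ (γ * k)) * (1 - x) ^ (-γ - 1)) (Set.Ioo 0 1) ∧
    (∫ x in Set.Ioo (0:ℝ) 1, (1 - x ^ (γ * k)) * (1 - x) ^ (-γ - 1)) ≤ k * (1 / (1 - γ)) := by
  have hb := ML_beta_ii 1 (1 - γ) one_pos (by linarith)
  have hg : Real.Gamma (1 - γ) ≠ 0 := (Real.Gamma_pos_of_pos (by linarith)).ne'
  have h1g : (1 - γ) ≠ 0 := by linarith
  have hv : Real.Gamma 1 * Real.Gamma (1 - γ) / Real.Gamma (1 + (1 - γ)) = 1 / (1 - γ) := by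
    rw [add_comm, Real.Gamma_add_one h1g, Real.Gamma_one]
    field_simp
  rw [hv, intervalIntegrable_iff_integrableOn_Ioo_of_le zero_le_one,
    intervalIntegral.integral_of_le zero_le_one, integral_Ioc_eq_integral_Ioo] at hb
  have hd := hb.1.const_mul (k:ℝ)
  have hle : ∀ x ∈ Set.Ioo (0:ℝ) 1, (1 - x ^ (γ * k)) * (1 - x) ^ (-γ - 1) ≤
      k * (x ^ ((1:ℝ) - 1) * (1 - x) ^ (1 - γ - 1)) := by
    intro x hx
    have hb2 := (ML_bern γ h0 h1 k x hx.1 hx.2.le).2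
    have hp : 0 < 1 - x := by linarith [hx.2]
    have : (1 - x) ^ (1 - γ - 1) = (1 - x) * (1 - x) ^ (-γ - 1) := by
      rw [show 1 - γ - 1 = 1 + (-γ - 1) by ring, Real.rpow_add hp, Real.rpow_one]
    rw [this, sub_self, Real.rpow_zero, one_mul, ← mul_assoc]
    exact mul_le_mul_of_nonneg_right hb2 (by positivity)
  have hint : IntegrableOn (fun x : ℝ => (1 - x ^ (γ * k)) * (1 - x) ^ (-γ - 1)) (Set.Ioo 0 1) := by
    refine Integrable.mono' hd ?_ ?_
    · apply Measurable.aestronglyMeasurable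
      fun_prop
    · filter_upwards [ae_restrict_mem measurableSet_Ioo] with x hx
      have hp : 0 < 1 - x := by linarith [hx.2]
      rw [Real.norm_of_nonneg]
      · exact hle x hx
      · exact mul_nonneg (ML_bern γ h0 h1 k x hx.1 hx.2.le).1 (by positivity)
  refine ⟨hint, ?_⟩
  rw [← hb.2, ← integral_const_mul]
  exact setIntegral_mono_on hint hd measurableSet_Ioo hle

/-- symbol -/
noncomputable def MLc (γ : ℝ) (k : ℕ) : ℝ :=
  Real.Gamma (γ * k + 1) * Real.Gamma (1 - γ) / Real.Gamma (γ * k + 1 - γ)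

lemma ML_c (γ : ℝ) (h0 : 0 < γ) (h1 : γ < 1) (k : ℕ) :
    MLc γ k = 1 + γ * ∫ x in Set.Ioo (0:ℝ) 1, (1 - x ^ (γ * k)) * (1 - x) ^ (-γ - 1) := by
  have hg : Real.Gamma (1 - γ) ≠ 0 := (Real.Gamma_pos_of_pos (by linarith)).ne'
  rcases Nat.eq_zero_or_pos k with rfl | hk
  · simp [MLc, hg]
  have hk' : (0:ℝ) < k := by exact_mod_cast hk
  have hp : 0 < γ * k := by positivity
  set p := γ * k with hpdef
  have hb := ML_beta_ii p (1 - γ) hp (by linarith)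
  have hI := (ML_int γ h0 h1 k).1
  rw [← hpdef, ← intervalIntegrable_iff_integrableOn_Ioo_of_le zero_le_one] at hI
  have key := intervalIntegral.integral_eq_sub_of_hasDerivAt_of_tendsto (a := (0:ℝ)) (b := 1)
    (f := fun x => (1 - x ^ p) * (1 - x) ^ (-γ))
    (f' := fun x => γ * ((1 - x ^ p) * (1 - x) ^ (-γ - 1)) -
      p * (x ^ (p - 1) * (1 - x) ^ (1 - γ - 1))) (fa := 1) (fb := 0) one_pos
    (by
      intro x hx
      have h2 : 0 < 1 - x := by linarith [hx.2]
      have d1 : HasDerivAt (fun x : ℝ => 1 - x ^ p) (-(p * x ^ (p - 1))) x :=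
        (Real.hasDerivAt_rpow_const (Or.inl hx.1.ne')).const_sub 1
      have d2 : HasDerivAt (fun x : ℝ => (1 - x) ^ (-γ)) (-1 * -γ * (1 - x) ^ (-γ - 1)) x :=
        ((hasDerivAt_id x).const_sub 1).rpow_const (Or.inl h2.ne')
      refine (d1.mul d2).congr_deriv ?_
      rw [show 1 - γ - 1 = -γ by ring]
      ring)
    ((hI.const_mul γ).sub (hb.1.const_mul p))
    (by
      have : ContinuousAt (fun x : ℝ => (1 - x ^ p) * (1 - x) ^ (-γ)) 0 := by
        apply ContinuousAt.mul
        · exact continuousAt_const.sub (Real.continuousAt_rpow_const _ _ (Or.inr hp.le))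
        · exact (continuousAt_const.sub continuousAt_id).rpow_const (Or.inl (by norm_num))
      have h := this.tendsto.mono_left (nhdsWithin_le_nhds (s := Set.Ioi 0))
      simpa [Real.zero_rpow hp.ne'] using h)
    (by
      have hz : Filter.Tendsto (fun x : ℝ => k * (1 - x) ^ (1 - γ)) (nhdsWithin 1 (Set.Iio 1)) (nhds 0) := by
        have : ContinuousAt (fun x : ℝ => k * (1 - x) ^ (1 - γ)) 1 := by
          apply ContinuousAt.mul continuousAt_const
          exact (continuousAt_const.sub continuousAt_id).rpow_const (Or.inr (by linarith))
        have h := this.tendsto.mono_left (nhdsWithin_le_nhds (s := Set.Iio 1))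
        simpa [Real.zero_rpow (by linarith : 1 - γ ≠ 0)] using h
      have hmem : Set.Ioo (0:ℝ) 1 ∈ nhdsWithin (1:ℝ) (Set.Iio 1) :=
        Ioo_mem_nhdsLT one_pos
      refine tendsto_of_tendsto_of_tendsto_of_le_of_le' tendsto_const_nhds hz ?_ ?_
      · filter_upwards [hmem] with x hx
        have h2 : 0 < 1 - x := by linarith [hx.2]
        exact mul_nonneg (ML_bern γ h0 h1 k x hx.1 hx.2.le).1 (by positivity)
      · filter_upwards [hmem] with x hx
        have h2 : 0 < 1 - x := by linarith [hx.2]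
        have : (1 - x) ^ (1 - γ) = (1 - x) * (1 - x) ^ (-γ) := by
          rw [show 1 - γ = 1 + (-γ) by ring, Real.rpow_add h2, Real.rpow_one]
        rw [this, ← mul_assoc]
        exact mul_le_mul_of_nonneg_right (ML_bern γ h0 h1 k x hx.1 hx.2.le).2 (by positivity))
  rw [intervalIntegral.integral_sub (hI.const_mul γ) (hb.1.const_mul p),
    intervalIntegral.integral_const_mul, intervalIntegral.integral_const_mul, hb.2,
    intervalIntegral.integral_of_le zero_le_one, integral_Ioc_eq_integral_Ioo] at key
  have : MLc γ k = p * (Real.Gamma p * Real.Gamma (1 - γ) / Real.Gamma (p + (1 - γ))) := by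
    rw [MLc, ← hpdef, Real.Gamma_add_one hp.ne', show p + 1 - γ = p + (1 - γ) by ring]
    ring
  linarith

lemma ML_nonneg (γ : ℝ) (h0 : 0 < γ) (h1 : γ < 1) (b : ℕ → ℝ)
    (hb : Summable fun k : ℕ => (k:ℝ) * |b k|) (hb0 : Summable b)
    (hpos : ∀ x ∈ Set.Ioo (0:ℝ) 1, 0 ≤ ∑' k : ℕ, b k * (1 - x ^ (γ * k))) :
    (∑' k, b k) ≤ ∑' k, MLc γ k * b k := by
  have hF := hasSum_integral_of_summable_integral_norm (μ := volume.restrict (Set.Ioo (0:ℝ) 1))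
    (F := fun (k : ℕ) (x : ℝ) => b k * ((1 - x ^ (γ * k)) * (1 - x) ^ (-γ - 1)))
    (fun k => ((ML_int γ h0 h1 k).1).const_mul (b k))
    (by
      refine Summable.of_nonneg_of_le (fun k => integral_nonneg fun x => norm_nonneg _) ?_
        (hb.mul_right (1 / (1 - γ)))
      intro k
      have : ∫ x in Set.Ioo (0:ℝ) 1, ‖b k * ((1 - x ^ (γ * k)) * (1 - x) ^ (-γ - 1))‖ =
          |b k| * ∫ x in Set.Ioo (0:ℝ) 1, ((1 - x ^ (γ * k)) * (1 - x) ^ (-γ - 1)) := by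
        rw [← integral_const_mul]
        refine setIntegral_congr_fun measurableSet_Ioo fun x hx => ?_
        have h2 : 0 < 1 - x := by linarith [hx.2]
        simp only [norm_mul, Real.norm_eq_abs]
        rw [abs_of_nonneg (ML_bern γ h0 h1 k x hx.1 hx.2.le).1, abs_of_pos (Real.rpow_pos_of_pos h2 (-γ - 1))]
      rw [this]
      calc _ ≤ |b k| * (k * (1 / (1 - γ))) :=
            mul_le_mul_of_nonneg_left (ML_int γ h0 h1 k).2 (abs_nonneg _)
        _ = _ := by ring)
  have hI : 0 ≤ ∫ x in Set.Ioo (0:ℝ) 1,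
      ∑' k : ℕ, b k * ((1 - x ^ (γ * k)) * (1 - x) ^ (-γ - 1)) := by
    refine setIntegral_nonneg measurableSet_Ioo fun x hx => ?_
    have h2 : 0 < 1 - x := by linarith [hx.2]
    simp_rw [← mul_assoc]
    rw [tsum_mul_right]
    exact mul_nonneg (hpos x hx) (by positivity)
  have hS := hb0.hasSum.add (hF.mul_left γ)
  have heq : (fun k => MLc γ k * b k) = fun k : ℕ => b k +
      γ * ∫ x in Set.Ioo (0:ℝ) 1, b k * ((1 - x ^ (γ * k)) * (1 - x) ^ (-γ - 1)) := by
    funext k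
    rw [ML_c γ h0 h1 k, integral_const_mul]
    ring
  rw [heq, hS.tsum_eq]
  have := mul_nonneg h0.le hI
  linarith

lemma MLc_nonneg (γ : ℝ) (h0 : 0 < γ) (h1 : γ < 1) (k : ℕ) : 0 ≤ MLc γ k := by
  have : 0 ≤ γ * k := by positivity
  unfold MLc
  have := Real.Gamma_pos_of_pos (by linarith : 0 < γ * k + 1)
  have := Real.Gamma_pos_of_pos (by linarith : 0 < 1 - γ)
  have := Real.Gamma_pos_of_pos (by linarith : 0 < γ * k + 1 - γ)
  positivity

lemma MLc_le (γ : ℝ) (h0 : 0 < γ) (h1 : γ < 1) (k : ℕ) :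
    MLc γ k ≤ (1 + 1 / (1 - γ)) * ((k:ℝ) + 1) := by
  rw [ML_c γ h0 h1 k]
  have h := (ML_int γ h0 h1 k).2
  have h2 : 0 ≤ 1 / (1 - γ) := by
    have : 0 < 1 - γ := by linarith
    positivity
  have hk : (0:ℝ) ≤ k := by positivity
  have h3 := mul_le_mul_of_nonneg_left h h0.le
  have h4 : γ * (k * (1 / (1 - γ))) ≤ 1 * (k * (1 / (1 - γ))) :=
    mul_le_mul_of_nonneg_right h1.le (by positivity)
  nlinarith

lemma ML_max (γ : ℝ) (h0 : 0 < γ) (h1 : γ < 1) (a : ℕ → ℂ)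
    (ha : ∀ X : ℝ, 0 ≤ X → Summable fun k : ℕ => ((k:ℝ) + 1) * ‖a k‖ * X ^ k)
    (x₀ : ℝ) (hx₀ : 0 ≤ x₀)
    (hmax : ∀ x ∈ Set.Icc 0 x₀, ‖∑' k, a k * (x:ℂ) ^ k‖ ≤ ‖∑' k, a k * (x₀:ℂ) ^ k‖) :
    ‖∑' k, a k * (x₀:ℂ) ^ k‖ ^ 2 ≤
      ((starRingEnd ℂ (∑' k, a k * (x₀:ℂ) ^ k)) * ∑' k, (MLc γ k : ℂ) * (a k * (x₀:ℂ) ^ k)).re := by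
  have hs : ∀ x : ℝ, 0 ≤ x → Summable fun k : ℕ => a k * (x:ℂ) ^ k := by
    intro x hx
    refine Summable.of_norm_bounded (ha x hx) fun k => ?_
    rw [norm_mul, norm_pow, Complex.norm_real, Real.norm_of_nonneg hx]
    have : 0 ≤ ‖a k‖ * x ^ k := by positivity
    have hk : (0:ℝ) ≤ k := by positivity
    nlinarith
  have hsc : Summable fun k : ℕ => (MLc γ k : ℂ) * (a k * (x₀:ℂ) ^ k) := by
    refine Summable.of_norm_bounded ((ha x₀ hx₀).mul_left (1 + 1 / (1 - γ))) fun k => ?_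
    rw [norm_mul, norm_mul, norm_pow, Complex.norm_real, Complex.norm_real,
      Real.norm_of_nonneg hx₀, Real.norm_of_nonneg (MLc_nonneg γ h0 h1 k)]
    have : 0 ≤ ‖a k‖ * x₀ ^ k := by positivity
    calc _ ≤ ((1 + 1 / (1 - γ)) * ((k:ℝ) + 1)) * (‖a k‖ * x₀ ^ k) :=
          mul_le_mul_of_nonneg_right (MLc_le γ h0 h1 k) this
      _ = _ := by ring
  set P := ∑' k, a k * (x₀:ℂ) ^ k with hP
  have hn := ML_nonneg γ h0 h1 (fun k => (starRingEnd ℂ P * (a k * (x₀:ℂ) ^ k)).re) ?_ ?_ ?_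
  · have e1 : ∑' k, (starRingEnd ℂ P * (a k * (x₀:ℂ) ^ k)).re = ‖P‖ ^ 2 := by
      rw [← Complex.re_tsum ((hs x₀ hx₀).mul_left _), tsum_mul_left, ← hP, mul_comm,
        Complex.mul_conj, Complex.ofReal_re, Complex.normSq_eq_norm_sq]
    have e2 : ∑' k, MLc γ k * (starRingEnd ℂ P * (a k * (x₀:ℂ) ^ k)).re =
        (starRingEnd ℂ P * ∑' k, (MLc γ k : ℂ) * (a k * (x₀:ℂ) ^ k)).re := by
      rw [← tsum_mul_left, Complex.re_tsum (hsc.mul_left _)]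
      congr 1
      funext k
      rw [← Complex.re_ofReal_mul]
      congr 1
      ring
    rw [← e1, ← e2]
    exact hn
  · refine Summable.of_nonneg_of_le (fun k => by positivity) ?_ ((ha x₀ hx₀).mul_left ‖P‖)
    intro k
    have h3 : |(starRingEnd ℂ P * (a k * (x₀:ℂ) ^ k)).re| ≤ ‖P‖ * (‖a k‖ * x₀ ^ k) := by
      refine (Complex.abs_re_le_norm _).trans ?_
      rw [norm_mul, norm_mul, norm_pow, Complex.norm_real, Real.norm_of_nonneg hx₀,
        RCLike.norm_conj]
    have hk : (0:ℝ) ≤ k := by positivity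
    have : 0 ≤ ‖P‖ * (‖a k‖ * x₀ ^ k) := by positivity
    calc _ ≤ (k:ℝ) * (‖P‖ * (‖a k‖ * x₀ ^ k)) := mul_le_mul_of_nonneg_left h3 hk
      _ ≤ _ := by nlinarith
  · exact (Complex.hasSum_re ((hs x₀ hx₀).mul_left (starRingEnd ℂ P)).hasSum).summable
  · intro x hx
    have hxg : 0 ≤ x ^ γ := Real.rpow_nonneg hx.1.le _
    have hxg1 : x ^ γ ≤ 1 := Real.rpow_le_one hx.1.le hx.2.le h0.le
    have hy0 : 0 ≤ x₀ * x ^ γ := by positivity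
    have hy1 : x₀ * x ^ γ ≤ x₀ := by nlinarith
    have hm := hmax (x₀ * x ^ γ) ⟨hy0, hy1⟩
    set Q := ∑' k, a k * ((x₀ * x ^ γ : ℝ) : ℂ) ^ k with hQ
    have e : ∑' k : ℕ, (starRingEnd ℂ P * (a k * (x₀:ℂ) ^ k)).re * (1 - x ^ (γ * k)) =
        (starRingEnd ℂ P * (P - Q)).re := by
      rw [hQ, hP, ← (hs x₀ hx₀).tsum_sub (hs _ hy0), ← tsum_mul_left,
        Complex.re_tsum (((hs x₀ hx₀).sub (hs _ hy0)).mul_left _), ← hP]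
      congr 1
      funext k
      rw [mul_comm _ (1 - x ^ (γ * (k:ℝ))), ← Complex.re_ofReal_mul]
      congr 1
      rw [Real.rpow_mul hx.1.le, Real.rpow_natCast]
      push_cast
      ring
    rw [e, mul_sub, Complex.sub_re, mul_comm _ P, Complex.mul_conj, Complex.ofReal_re,
      Complex.normSq_eq_norm_sq]
    have : (starRingEnd ℂ P * Q).re ≤ ‖P‖ * ‖Q‖ := by
      refine (Complex.re_le_norm _).trans ?_
      rw [norm_mul, RCLike.norm_conj]
    nlinarith [norm_nonneg P]

lemma ML_bound (γ : ℝ) (h0 : 0 < γ) (h1 : γ < 1) (a : ℕ → ℂ)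
    (ha : ∀ X : ℝ, 0 ≤ X → Summable fun k : ℕ => ((k:ℝ) + 1) * ‖a k‖ * X ^ k)
    (r : ℝ → ℂ) (G R X : ℝ) (hX : 0 ≤ X)
    (hr : ∀ x ∈ Set.Icc 0 X, ‖r x‖ ≤ R)
    (heq : ∀ x ∈ Set.Icc 0 X, ∑' k, (MLc γ k : ℂ) * (a k * (x:ℂ) ^ k) =
      Complex.I * (G * x : ℝ) * (∑' k, a k * (x:ℂ) ^ k) + r x) :
    ‖∑' k, a k * (X:ℂ) ^ k‖ ≤ R := by
  have hcont : ContinuousOn (fun x : ℝ => ‖∑' k, a k * (x:ℂ) ^ k‖) (Set.Icc 0 X) := by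
    apply ContinuousOn.norm
    refine continuousOn_tsum (u := fun k : ℕ => ((k:ℝ) + 1) * ‖a k‖ * X ^ k) ?_ (ha X hX) ?_
    · intro k
      fun_prop
    · intro k x hx
      rw [norm_mul, norm_pow, Complex.norm_real, Real.norm_of_nonneg hx.1]
      have h3 : x ^ k ≤ X ^ k := pow_le_pow_left₀ hx.1 hx.2 k
      have h4 : 0 ≤ X ^ k := by positivity
      have hk : (0:ℝ) ≤ k := by positivity
      calc ‖a k‖ * x ^ k ≤ ‖a k‖ * X ^ k := mul_le_mul_of_nonneg_left h3 (norm_nonneg _)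
        _ ≤ _ := by nlinarith [mul_nonneg (norm_nonneg (a k)) h4]
  obtain ⟨x₀, hx₀, hm⟩ := isCompact_Icc.exists_isMaxOn ⟨X, hX, le_rfl⟩ hcont
  have h2 := ML_max γ h0 h1 a ha x₀ hx₀.1 (fun x hx => hm ⟨hx.1, hx.2.trans hx₀.2⟩)
  rw [heq x₀ hx₀] at h2
  refine (hm (⟨hX, le_rfl⟩ : X ∈ Set.Icc 0 X)).trans ?_
  refine le_trans ?_ (hr x₀ hx₀)
  simp only
  set P := ∑' k, a k * (x₀:ℂ) ^ k
  have e : (starRingEnd ℂ P * (Complex.I * (G * x₀ : ℝ) * P + r x₀)).re =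
      (starRingEnd ℂ P * r x₀).re := by
    have : starRingEnd ℂ P * (Complex.I * (G * x₀ : ℝ) * P + r x₀) =
        (P * starRingEnd ℂ P) * (Complex.I * (G * x₀ : ℝ)) + starRingEnd ℂ P * r x₀ := by ring
    rw [this, Complex.mul_conj, Complex.add_re, Complex.re_ofReal_mul]
    simp
  rw [e] at h2
  have h3 : (starRingEnd ℂ P * r x₀).re ≤ ‖P‖ * ‖r x₀‖ := by
    refine (Complex.re_le_norm _).trans ?_
    rw [norm_mul, RCLike.norm_conj]
  by_contra hc
  push Not at hc
  nlinarith [norm_nonneg (r x₀), norm_nonneg P]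

lemma ML_summable (γ : ℝ) (h0 : 1 / 2 ≤ γ) (X : ℝ) (hX : 0 ≤ X) :
    Summable fun k : ℕ => X ^ k / Real.Gamma (γ * k + 1) := by
  have hf := (Real.summable_pow_div_factorial (X ^ 2))
  have hG : ∀ m k : ℕ, 1 ≤ m → 2 * m ≤ k → (m.factorial : ℝ) ≤ Real.Gamma (γ * k + 1) := by
    intro m k hm hk
    have hm' : (1:ℝ) ≤ m := by exact_mod_cast hm
    have hk' : 2 * (m:ℝ) ≤ k := by exact_mod_cast hk
    have hle : (m:ℝ) + 1 ≤ γ * k + 1 := by nlinarith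
    rw [← Real.Gamma_nat_eq_factorial]
    exact Real.Gamma_strictMonoOn_Ici.monotoneOn (by simp; linarith) (by simp; linarith) hle
  have hpos : ∀ m : ℕ, 0 < (m.factorial : ℝ) := fun m => by exact_mod_cast m.factorial_pos
  apply Summable.even_add_odd
  · refine Summable.of_norm_bounded_eventually_nat hf ?_
    filter_upwards [Filter.eventually_ge_atTop 1] with m hm
    have h := hG m (2 * m) hm le_rfl
    have hp := (hpos m).trans_le h
    rw [Real.norm_of_nonneg (by positivity), ← pow_mul]
    exact div_le_div_of_nonneg_left (by positivity) (hpos m) h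
  · refine Summable.of_norm_bounded_eventually_nat (hf.mul_left X) ?_
    filter_upwards [Filter.eventually_ge_atTop 1] with m hm
    have h := hG m (2 * m + 1) hm (by omega)
    have hp := (hpos m).trans_le h
    rw [Real.norm_of_nonneg (by positivity), ← pow_mul, ← mul_div_assoc, ← pow_succ']
    exact div_le_div_of_nonneg_left (by positivity) (hpos m) h

lemma ML_summable' (γ : ℝ) (h0 : 1 / 2 ≤ γ) (n : ℕ) (X : ℝ) (hX : 0 ≤ X) :
    Summable fun k : ℕ => ((k:ℝ) + 1) ^ n * (X ^ k / Real.Gamma (γ * k + 1)) := by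
  refine Summable.of_nonneg_of_le ?_ ?_ (ML_summable γ h0 (2 ^ n * X) (by positivity)|>.mul_left (2 ^ n))
  · intro k
    have := Real.Gamma_pos_of_pos (by positivity : 0 < γ * k + 1)
    positivity
  · intro k
    have := Real.Gamma_pos_of_pos (by positivity : 0 < γ * k + 1)
    have h2 : ((k:ℝ) + 1) ≤ 2 ^ (k + 1) := by
      exact_mod_cast (Nat.lt_two_pow_self (n := k + 1)).le
    have h3 : ((k:ℝ) + 1) ^ n ≤ (2 ^ (k + 1)) ^ n := pow_le_pow_left₀ (by positivity) h2 n
    calc _ ≤ ((2:ℝ) ^ (k + 1)) ^ n * (X ^ k / Real.Gamma (γ * k + 1)) :=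
          mul_le_mul_of_nonneg_right h3 (by positivity)
      _ = _ := by rw [mul_pow, ← pow_mul, ← pow_mul, add_mul, pow_add, one_mul, mul_comm k n]; ring

/-- coefficients of `E_γ(i x)` -/
noncomputable def MLA (γ : ℝ) (k : ℕ) : ℂ := Complex.I ^ k * ((Real.Gamma (γ * k + 1))⁻¹ : ℝ)

lemma MLA_norm (γ : ℝ) (h0 : 0 < γ) (k : ℕ) : ‖MLA γ k‖ = (Real.Gamma (γ * k + 1))⁻¹ := by
  have := Real.Gamma_pos_of_pos (by positivity : 0 < γ * k + 1)
  rw [MLA, norm_mul, norm_pow, Complex.norm_I, one_pow, one_mul, Complex.norm_real,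
    Real.norm_of_nonneg (by positivity)]

lemma MLA_succ (γ : ℝ) (h0 : 0 < γ) (k : ℕ) :
    (MLc γ (k + 1) : ℂ) * MLA γ (k + 1) = Complex.I * (Real.Gamma (1 - γ) : ℝ) * MLA γ k := by
  have h1 := Real.Gamma_pos_of_pos (by positivity : 0 < γ * ((k + 1 : ℕ) : ℝ) + 1)
  have h2 : γ * ((k + 1 : ℕ) : ℝ) + 1 - γ = γ * k + 1 := by push_cast; ring
  have h3 : MLc γ (k + 1) * (Real.Gamma (γ * ((k + 1 : ℕ) : ℝ) + 1))⁻¹ =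
      Real.Gamma (1 - γ) * (Real.Gamma (γ * k + 1))⁻¹ := by
    rw [MLc, h2]
    field_simp
  unfold MLA
  rw [mul_left_comm, ← Complex.ofReal_mul, h3, pow_succ, Complex.ofReal_mul]
  ring

lemma MLA_summable (γ : ℝ) (h0 : 1 / 2 ≤ γ) (w : ℕ → ℝ) (hw : ∀ k, |w k| ≤ ((k:ℝ) + 1) ^ 3)
    (X : ℝ) (hX : 0 ≤ X) : Summable fun k : ℕ => ((k:ℝ) + 1) * ‖(w k : ℂ) * MLA γ k‖ * X ^ k := by
  refine Summable.of_nonneg_of_le (fun k => by positivity) ?_ (ML_summable' γ h0 4 X hX)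
  intro k
  have := Real.Gamma_pos_of_pos (by positivity : 0 < γ * k + 1)
  rw [norm_mul, MLA_norm γ (by linarith), Complex.norm_real, Real.norm_eq_abs]
  calc _ ≤ ((k:ℝ) + 1) * (((k:ℝ) + 1) ^ 3 * (Real.Gamma (γ * k + 1))⁻¹) * X ^ k := by
        gcongr
        exact hw k
    _ = _ := by ring

lemma MLA_summable0 (γ : ℝ) (h0 : 1 / 2 ≤ γ) (w : ℕ → ℝ) (hw : ∀ k, |w k| ≤ ((k:ℝ) + 1) ^ 3)
    (X : ℝ) (hX : 0 ≤ X) : Summable fun k : ℕ => (w k : ℂ) * MLA γ k * (X:ℂ) ^ k := by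
  refine Summable.of_norm_bounded (MLA_summable γ h0 w hw X hX) fun k => ?_
  rw [norm_mul, norm_pow, Complex.norm_real, Real.norm_of_nonneg hX]
  have : 0 ≤ ‖(w k : ℂ) * MLA γ k‖ * X ^ k := by positivity
  have hk : (0:ℝ) ≤ k := by positivity
  nlinarith

lemma MLA_shift (γ : ℝ) (h0 : 1 / 2 ≤ γ) (h1 : γ < 1) (w : ℕ → ℝ)
    (hw : ∀ k, |w (k + 1)| ≤ ((k:ℝ) + 1) ^ 3) (x : ℝ) (hx : 0 ≤ x) :
    ∑' k, (MLc γ k : ℂ) * ((w k : ℂ) * MLA γ k * (x:ℂ) ^ k) =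
      w 0 + Complex.I * (Real.Gamma (1 - γ) * x : ℝ) *
        ∑' k, ((w (k + 1) : ℝ) : ℂ) * MLA γ k * (x:ℂ) ^ k := by
  have hs := MLA_summable0 γ h0 (fun k => w (k + 1)) hw x hx
  have he : ∀ k : ℕ, (MLc γ (k + 1) : ℂ) * ((w (k + 1) : ℂ) * MLA γ (k + 1) * (x:ℂ) ^ (k + 1)) =
      Complex.I * (Real.Gamma (1 - γ) * x : ℝ) * (((w (k + 1) : ℝ) : ℂ) * MLA γ k * (x:ℂ) ^ k) := by
    intro k
    have := MLA_succ γ (by linarith) k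
    calc _ = ((MLc γ (k + 1) : ℂ) * MLA γ (k + 1)) * ((w (k + 1) : ℂ) * (x:ℂ) ^ (k + 1)) := by ring
      _ = _ := by rw [this]; push_cast; ring
  have hs' : Summable fun k => (MLc γ k : ℂ) * ((w k : ℂ) * MLA γ k * (x:ℂ) ^ k) := by
    rw [← summable_nat_add_iff 1]
    simp_rw [he]
    exact hs.mul_left _
  rw [hs'.tsum_eq_zero_add]
  simp_rw [he]
  rw [tsum_mul_left]
  congr 1
  have hg : Real.Gamma (1 - γ) ≠ 0 := (Real.Gamma_pos_of_pos (by linarith)).ne'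
  simp [MLc, MLA, hg]

lemma ML_B0 (γ : ℝ) (h0 : 1 / 2 ≤ γ) (h1 : γ < 1) (x : ℝ) (hx : 0 ≤ x) :
    ‖∑' k, ((1:ℝ) : ℂ) * MLA γ k * (x:ℂ) ^ k‖ ≤ 1 := by
  have hw : ∀ k : ℕ, |(1:ℝ)| ≤ ((k:ℝ) + 1) ^ 3 := by
    intro k
    rw [abs_one]
    exact one_le_pow₀ (by linarith [(by positivity : (0:ℝ) ≤ k)])
  refine ML_bound γ (by linarith) h1 (fun k => ((1:ℝ) : ℂ) * MLA γ k)
    (MLA_summable γ h0 (fun _ => 1) hw) (fun _ => 1) (Real.Gamma (1 - γ)) 1 x hx (by simp) ?_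
  intro y hy
  have := MLA_shift γ h0 h1 (fun _ => 1) hw y hy.1
  rw [this, add_comm]
  simp

lemma ML_B1 (γ : ℝ) (h0 : 1 / 2 ≤ γ) (h1 : γ < 1) (x : ℝ) (hx : 0 ≤ x) :
    ‖∑' k : ℕ, ((k:ℝ) : ℂ) * MLA γ k * (x:ℂ) ^ k‖ ≤ Real.Gamma (1 - γ) * x := by
  have hg : 0 < Real.Gamma (1 - γ) := (Real.Gamma_pos_of_pos (by linarith))
  have hw0 : ∀ k : ℕ, |(1:ℝ)| ≤ ((k:ℝ) + 1) ^ 3 := by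
    intro k
    rw [abs_one]
    exact one_le_pow₀ (by linarith [(by positivity : (0:ℝ) ≤ k)])
  have hw : ∀ k : ℕ, |(k:ℝ)| ≤ ((k:ℝ) + 1) ^ 3 := by
    intro k
    have : (0:ℝ) ≤ k := by positivity
    rw [abs_of_nonneg this]
    nlinarith [pow_nonneg this 3, pow_nonneg this 2]
  have hw' : ∀ k : ℕ, |((k + 1 : ℕ):ℝ)| ≤ ((k:ℝ) + 1) ^ 3 := by
    intro k
    have : (0:ℝ) ≤ k := by positivity
    rw [abs_of_nonneg (by positivity)]
    push_cast
    nlinarith [pow_nonneg this 3, pow_nonneg this 2]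
  refine ML_bound γ (by linarith) h1 (fun k : ℕ => ((k:ℝ) : ℂ) * MLA γ k)
    (MLA_summable γ h0 (fun k => (k:ℝ)) hw)
    (fun y => Complex.I * (Real.Gamma (1 - γ) * y : ℝ) * ∑' k, ((1:ℝ) : ℂ) * MLA γ k * (y:ℂ) ^ k)
    (Real.Gamma (1 - γ)) _ x hx ?_ ?_
  · intro y hy
    have hB := ML_B0 γ h0 h1 y hy.1
    rw [norm_mul, norm_mul, Complex.norm_I, one_mul, Complex.norm_real,
      Real.norm_of_nonneg (mul_nonneg hg.le hy.1)]
    calc _ ≤ Real.Gamma (1 - γ) * y * 1 :=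
          mul_le_mul_of_nonneg_left hB (mul_nonneg hg.le hy.1)
      _ ≤ _ := by nlinarith [hy.2]
  · intro y hy
    rw [MLA_shift γ h0 h1 (fun k => (k:ℝ)) hw' y hy.1, ← mul_add,
      ← (MLA_summable0 γ h0 (fun k => (k:ℝ)) hw y hy.1).tsum_add
        (MLA_summable0 γ h0 (fun _ => 1) hw0 y hy.1)]
    simp only [Nat.cast_zero, Complex.ofReal_zero, zero_add]
    congr 2
    funext k
    push_cast
    ring

lemma ML_B2 (γ : ℝ) (h0 : 1 / 2 ≤ γ) (h1 : γ < 1) (x : ℝ) (hx : 0 ≤ x) :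
    ‖∑' k : ℕ, ((k * (k - 1) : ℝ) : ℂ) * MLA γ k * (x:ℂ) ^ k‖ ≤
      2 * Real.Gamma (1 - γ) ^ 2 * x ^ 2 := by
  have hg : 0 < Real.Gamma (1 - γ) := (Real.Gamma_pos_of_pos (by linarith))
  have hw1 : ∀ k : ℕ, |(k:ℝ)| ≤ ((k:ℝ) + 1) ^ 3 := by
    intro k
    have : (0:ℝ) ≤ k := by positivity
    rw [abs_of_nonneg this]
    nlinarith [pow_nonneg this 3, pow_nonneg this 2]
  have hw : ∀ k : ℕ, |(k * (k - 1) : ℝ)| ≤ ((k:ℝ) + 1) ^ 3 := by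
    intro k
    have : (0:ℝ) ≤ k := by positivity
    rw [abs_le]
    constructor <;> nlinarith [pow_nonneg this 3, pow_nonneg this 2]
  have hw' : ∀ k : ℕ, |(((k + 1 : ℕ):ℝ) * (((k + 1 : ℕ):ℝ) - 1))| ≤ ((k:ℝ) + 1) ^ 3 := by
    intro k
    have : (0:ℝ) ≤ k := by positivity
    push_cast
    rw [abs_le]
    constructor <;> nlinarith [pow_nonneg this 3, pow_nonneg this 2]
  refine ML_bound γ (by linarith) h1 (fun k : ℕ => ((k * (k - 1) : ℝ) : ℂ) * MLA γ k)
    (MLA_summable γ h0 (fun k => (k * (k - 1) : ℝ)) hw)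
    (fun y => Complex.I * (Real.Gamma (1 - γ) * y : ℝ) *
      (2 * ∑' k : ℕ, ((k:ℝ) : ℂ) * MLA γ k * (y:ℂ) ^ k))
    (Real.Gamma (1 - γ)) _ x hx ?_ ?_
  · intro y hy
    have hB := ML_B1 γ h0 h1 y hy.1
    rw [norm_mul, norm_mul, Complex.norm_I, one_mul, Complex.norm_real,
      Real.norm_of_nonneg (mul_nonneg hg.le hy.1), norm_mul, Complex.norm_ofNat]
    calc _ ≤ Real.Gamma (1 - γ) * y * (2 * (Real.Gamma (1 - γ) * y)) :=
          mul_le_mul_of_nonneg_left (by linarith) (mul_nonneg hg.le hy.1)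
      _ = 2 * Real.Gamma (1 - γ) ^ 2 * y ^ 2 := by ring
      _ ≤ _ := mul_le_mul_of_nonneg_left (pow_le_pow_left₀ hy.1 hy.2 2) (by positivity)
  · intro y hy
    rw [MLA_shift γ h0 h1 (fun k => (k * (k - 1) : ℝ)) hw' y hy.1, ← mul_add, ← tsum_mul_left (a := (2:ℂ)),
      ← (MLA_summable0 γ h0 (fun k => (k * (k - 1) : ℝ)) hw y hy.1).tsum_add
        ((MLA_summable0 γ h0 (fun k => (k:ℝ)) hw1 y hy.1).mul_left 2)]
    simp only [Nat.cast_zero, zero_mul, Complex.ofReal_zero, zero_add]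
    congr 2
    funext k
    push_cast
    ring

lemma ML_even (α : ℝ) (h0 : 1 ≤ α) (w : ℕ → ℝ) (hw : ∀ k, |w k| ≤ ((k:ℝ) + 1) ^ 3)
    (y : ℝ) (hy : 0 ≤ y) :
    HasSum (fun m : ℕ => w (2 * m) * ((-(y ^ 2)) ^ m / Real.Gamma (α * m + 1)))
      (∑' k, (w k : ℂ) * MLA (α / 2) k * (y:ℂ) ^ k).re := by
  have hs := Complex.hasSum_re (MLA_summable0 (α / 2) (by linarith) w hw y hy).hasSum
  have hterm : ∀ k : ℕ, ((w k : ℂ) * MLA (α / 2) k * (y:ℂ) ^ k).re =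
      (w k * ((Real.Gamma (α / 2 * k + 1))⁻¹ * y ^ k)) * (Complex.I ^ k).re := by
    intro k
    rw [← Complex.re_ofReal_mul]
    congr 1
    rw [MLA]
    push_cast
    ring
  simp_rw [hterm] at hs
  have hinj : Function.Injective (fun m : ℕ => 2 * m) := fun a b h => by simpa using h
  rw [← hinj.hasSum_iff] at hs
  · convert hs using 1
    funext m
    simp only [Function.comp]
    have e1 : α / 2 * ((2 * m : ℕ) : ℝ) = α * m := by push_cast; ring
    have e2 : (Complex.I ^ (2 * m)).re = (-1) ^ m := by
      rw [pow_mul, Complex.I_sq]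
      have : ((-1 : ℂ)) ^ m = (((-1 : ℝ) ^ m : ℝ) : ℂ) := by push_cast; rfl
      rw [this, Complex.ofReal_re]
    rw [e1, e2, pow_mul, neg_pow]
    ring
  · intro k hk
    have hodd : ¬ Even k := by
      rintro ⟨m, hm⟩
      exact hk ⟨m, by simp only; omega⟩
    obtain ⟨m, rfl⟩ := Nat.not_even_iff_odd.mp hodd
    have e2 : (Complex.I ^ (2 * m + 1)).re = 0 := by
      rw [pow_succ, pow_mul, Complex.I_sq]
      have : ((-1 : ℂ)) ^ m = (((-1 : ℝ) ^ m : ℝ) : ℂ) := by push_cast; rfl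
      rw [this, Complex.re_ofReal_mul]
      simp
    rw [e2, mul_zero]

lemma ML_w1 : ∀ k : ℕ, |(k:ℝ)| ≤ ((k:ℝ) + 1) ^ 3 := by
  intro k
  have : (0:ℝ) ≤ k := by positivity
  rw [abs_of_nonneg this]
  nlinarith [pow_nonneg this 3, pow_nonneg this 2]

lemma ML_w2 : ∀ k : ℕ, |(k * (k - 1) : ℝ)| ≤ ((k:ℝ) + 1) ^ 3 := by
  intro k
  have : (0:ℝ) ≤ k := by positivity
  rw [abs_le]
  constructor <;> nlinarith [pow_nonneg this 3, pow_nonneg this 2]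

lemma ML_G1 (α : ℝ) (h0 : 1 < α) (m : ℕ) :
    (Real.Gamma (α * m + α))⁻¹ = α * (m + 1) / Real.Gamma (α * ((m + 1 : ℕ) : ℝ) + 1) := by
  have hp : 0 < α * m + α := by positivity
  have h1 := Real.Gamma_pos_of_pos hp
  have : α * ((m + 1 : ℕ) : ℝ) = α * m + α := by push_cast; ring
  rw [this, Real.Gamma_add_one hp.ne']
  field_simp

lemma ML_G2 (α : ℝ) (h0 : 1 < α) (m : ℕ) :
    (Real.Gamma (α * m + (α - 1)))⁻¹ = α * (m + 1) * (α * (m + 1) - 1) /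
      Real.Gamma (α * ((m + 1 : ℕ) : ℝ) + 1) := by
  have hm : 0 ≤ α * m := by positivity
  have hp : 0 < α * m + (α - 1) := by linarith
  have h1 := Real.Gamma_pos_of_pos hp
  have e := ML_G1 α h0 m
  have e2 : α * m + α = (α * m + (α - 1)) + 1 := by ring
  rw [e2, Real.Gamma_add_one hp.ne'] at e
  rw [mul_comm (α * (m + 1)), mul_div_assoc, ← e,
    show α * ((m:ℝ) + 1) - 1 = α * m + (α - 1) by ring]
  field_simp

lemma ML_E1 (α : ℝ) (h0 : 1 < α) (y : ℝ) (hy : 0 ≤ y) :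
    -(y ^ 2) * mittagLeffler α α (-(y ^ 2)) =
      α / 2 * (∑' k : ℕ, ((k:ℝ) : ℂ) * MLA (α / 2) k * (y:ℂ) ^ k).re := by
  have h := ML_even α h0.le (fun k => (k:ℝ)) ML_w1 y hy
  rw [← h.tsum_eq, h.summable.tsum_eq_zero_add, mittagLeffler, ← tsum_mul_left]
  simp only [Nat.mul_zero, Nat.cast_zero, zero_mul, zero_add]
  rw [← tsum_mul_left]
  congr 1
  funext m
  rw [div_eq_mul_inv _ (Real.Gamma (α * m + α)), ML_G1 α h0 m, pow_succ]
  push_cast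
  ring

lemma ML_E2 (α : ℝ) (h0 : 1 < α) (y : ℝ) (hy : 0 ≤ y) :
    -(y ^ 2) * mittagLeffler α (α - 1) (-(y ^ 2)) =
      α ^ 2 / 4 * (∑' k : ℕ, ((k * (k - 1) : ℝ) : ℂ) * MLA (α / 2) k * (y:ℂ) ^ k).re +
      (α ^ 2 / 4 - α / 2) * (∑' k : ℕ, ((k:ℝ) : ℂ) * MLA (α / 2) k * (y:ℂ) ^ k).re := by
  have h1 := ML_even α h0.le (fun k => (k:ℝ)) ML_w1 y hy
  have h2 := ML_even α h0.le (fun k => (k * (k - 1):ℝ)) ML_w2 y hy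
  have h := (h2.mul_left (α ^ 2 / 4)).add (h1.mul_left (α ^ 2 / 4 - α / 2))
  rw [← h.tsum_eq, h.summable.tsum_eq_zero_add, mittagLeffler, ← tsum_mul_left]
  simp only [Nat.mul_zero, Nat.cast_zero, zero_mul, mul_zero, zero_add]
  congr 1
  funext m
  rw [div_eq_mul_inv _ (Real.Gamma (α * m + (α - 1))), ML_G2 α h0 m, pow_succ]
  push_cast
  ring

lemma ML_est1 (α : ℝ) (h0 : 1 < α) (h2 : α < 2) :
    ∃ C > (0:ℝ), ∀ y : ℝ, 0 < y → y * |mittagLeffler α α (-(y ^ 2))| ≤ C := by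
  have hg : 0 < Real.Gamma (1 - α / 2) := Real.Gamma_pos_of_pos (by linarith)
  refine ⟨α / 2 * Real.Gamma (1 - α / 2), by positivity, fun y hy => ?_⟩
  have hB := (Complex.abs_re_le_norm _).trans (ML_B1 (α / 2) (by linarith) (by linarith) y hy.le)
  have h := congrArg abs (ML_E1 α h0 y hy.le)
  rw [abs_mul, abs_mul, abs_neg, abs_of_pos (by positivity : 0 < y ^ 2),
    abs_of_pos (by linarith : 0 < α / 2)] at h
  have h3 := mul_le_mul_of_nonneg_left hB (by linarith : 0 ≤ α / 2)
  rw [← h] at h3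
  have : y * (y * |mittagLeffler α α (-(y ^ 2))|) ≤ y * (α / 2 * Real.Gamma (1 - α / 2)) := by
    linarith
  exact le_of_mul_le_mul_left this hy

lemma ML_est2 (α : ℝ) (h0 : 1 < α) (h2 : α < 2) :
    ∃ C > (0:ℝ), ∀ y : ℝ, 0 < y → |mittagLeffler α (α - 1) (-(y ^ 2))| ≤ C := by
  have hg : 0 < Real.Gamma (1 - α / 2) := Real.Gamma_pos_of_pos (by linarith)
  have hS : Summable fun m : ℕ => (Real.Gamma (α * m + (α - 1)))⁻¹ := by
    have hs := (summable_nat_add_iff 1).2 (ML_summable' α (by linarith) 2 1 zero_le_one)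
    refine Summable.of_nonneg_of_le ?_ ?_ (hs.mul_left 4)
    · intro m
      have hm : 0 ≤ α * m := by positivity
      have := Real.Gamma_pos_of_pos (by linarith : 0 < α * m + (α - 1))
      positivity
    · intro m
      rw [ML_G2 α h0 m]
      have := Real.Gamma_pos_of_pos (by positivity : 0 < α * ((m + 1 : ℕ) : ℝ) + 1)
      rw [one_pow, mul_one_div, ← mul_div_assoc]
      apply div_le_div_of_nonneg_right _ this.le
      push_cast
      have hm : (0:ℝ) ≤ m := by positivity
      have h5 : α * ((m:ℝ) + 1) ≤ 2 * (m + 1 + 1) := by nlinarith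
      have h6 : 1 ≤ α * ((m:ℝ) + 1) := by nlinarith
      nlinarith
  set G := Real.Gamma (1 - α / 2)
  set S := ∑' m : ℕ, (Real.Gamma (α * m + (α - 1)))⁻¹ with hSdef
  refine ⟨|S| + (α ^ 2 / 4 * (2 * G ^ 2) + |α ^ 2 / 4 - α / 2| * G), by positivity, fun y hy => ?_⟩
  rcases le_total y 1 with hy1 | hy1
  · have hb : |mittagLeffler α (α - 1) (-(y ^ 2))| ≤ S := by
      rw [mittagLeffler, ← Real.norm_eq_abs]
      refine tsum_of_norm_bounded hS.hasSum fun m => ?_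
      have hm : 0 ≤ α * m := by positivity
      have hG := Real.Gamma_pos_of_pos (by linarith : 0 < α * m + (α - 1))
      rw [norm_div, norm_pow, norm_neg, Real.norm_of_nonneg hG.le,
        Real.norm_of_nonneg (by positivity : 0 ≤ y ^ 2), ← one_div]
      exact div_le_div_of_nonneg_right (pow_le_one₀ (by positivity) (pow_le_one₀ hy.le hy1)) hG.le
    have : 0 ≤ α ^ 2 / 4 * (2 * G ^ 2) + |α ^ 2 / 4 - α / 2| * G := by positivity
    linarith [le_abs_self S]
  · have hB1 := (Complex.abs_re_le_norm _).trans (ML_B1 (α / 2) (by linarith) (by linarith) y hy.le)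
    have hB2 := (Complex.abs_re_le_norm _).trans (ML_B2 (α / 2) (by linarith) (by linarith) y hy.le)
    have h := congrArg abs (ML_E2 α h0 y hy.le)
    have h3 := h.le.trans (abs_add_le _ _)
    rw [abs_mul, abs_mul, abs_mul, abs_neg, abs_of_pos (by positivity : 0 < y ^ 2),
      abs_of_pos (by positivity : 0 < α ^ 2 / 4)] at h3
    have h4 := mul_le_mul_of_nonneg_left hB1 (abs_nonneg (α ^ 2 / 4 - α / 2))
    have h5 := mul_le_mul_of_nonneg_left hB2 (by positivity : 0 ≤ α ^ 2 / 4)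
    have h6 : |α ^ 2 / 4 - α / 2| * (G * y) ≤ |α ^ 2 / 4 - α / 2| * (G * y ^ 2) := by
      gcongr
      nlinarith
    have h7 : 0 ≤ y ^ 2 * |S| := by positivity
    refine le_of_mul_le_mul_left (a := y ^ 2) ?_ (by positivity)
    nlinarith

theorem petrovsky_derivative_series_L1_bound (α : ℝ) (hα₁ : 1 < α) (hα₂ : α < 2) :
    ∃ C > (0 : ℝ), ∀ T : ℝ, 0 < T → ∀ lam a b : ℕ → ℝ, (∀ n, 0 < lam n) →
      (Summable fun n => lam n * (a n) ^ 2) → (Summable fun n => (b n) ^ 2) →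
      (∫ t in Set.Ioo (0 : ℝ) T,
          Real.sqrt (∑' n, lam n *
            (a n * t ^ (α - 2) * mittagLeffler α (α - 1) (-(lam n) * t ^ α) +
              b n * t ^ (α - 1) * mittagLeffler α α (-(lam n) * t ^ α)) ^ 2)) ≤
        C * (T ^ (α - 1) * Real.sqrt (∑' n, lam n * (a n) ^ 2) +
          T ^ (α / 2) * Real.sqrt (∑' n, (b n) ^ 2)) := by
  obtain ⟨C1, hC1, hE1⟩ := ML_est1 α hα₁ hα₂
  obtain ⟨C2, hC2, hE2⟩ := ML_est2 α hα₁ hα₂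
  have hα1 : 0 < α - 1 := by linarith
  have hα0 : 0 < α / 2 := by linarith
  set K1 := 2 * C2 / (α - 1) with hK1
  set K2 := 2 * C1 / (α / 2) with hK2
  have hK1p : 0 < K1 := by positivity
  have hK2p : 0 < K2 := by positivity
  refine ⟨K1 + K2, by positivity, ?_⟩
  intro T hT lam a b hlam ha hb
  set A := Real.sqrt (∑' n, lam n * (a n) ^ 2) with hA
  set B := Real.sqrt (∑' n, (b n) ^ 2) with hB
  have hA0 : 0 ≤ A := Real.sqrt_nonneg _
  have hB0 : 0 ≤ B := Real.sqrt_nonneg _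
  have hAsq : A ^ 2 = ∑' n, lam n * (a n) ^ 2 :=
    Real.sq_sqrt (tsum_nonneg fun n => mul_nonneg (hlam n).le (sq_nonneg _))
  have hBsq : B ^ 2 = ∑' n, (b n) ^ 2 := Real.sq_sqrt (tsum_nonneg fun n => sq_nonneg _)
  -- pointwise bound
  have hpt : ∀ t ∈ Set.Ioo (0:ℝ) T, Real.sqrt (∑' n, lam n *
            (a n * t ^ (α - 2) * mittagLeffler α (α - 1) (-(lam n) * t ^ α) +
              b n * t ^ (α - 1) * mittagLeffler α α (-(lam n) * t ^ α)) ^ 2) ≤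
      2 * C2 * A * t ^ (α - 2) + 2 * C1 * B * t ^ (α / 2 - 1) := by
    intro t ht
    have ht0 : 0 < t := ht.1
    set p := t ^ (α - 2) with hp
    set q := t ^ (α / 2 - 1) with hq
    have hp0 : 0 < p := Real.rpow_pos_of_pos ht0 _
    have hq0 : 0 < q := Real.rpow_pos_of_pos ht0 _
    have hterm : ∀ n, lam n *
            (a n * p * mittagLeffler α (α - 1) (-(lam n) * t ^ α) +
              b n * t ^ (α - 1) * mittagLeffler α α (-(lam n) * t ^ α)) ^ 2 ≤
        2 * (C2 * p) ^ 2 * (lam n * (a n) ^ 2) + 2 * (C1 * q) ^ 2 * (b n) ^ 2 := by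
      intro n
      have hl := hlam n
      set s := Real.sqrt (lam n) with hs
      have hs0 : 0 < s := Real.sqrt_pos.2 hl
      have hss : s ^ 2 = lam n := Real.sq_sqrt hl.le
      set z := t ^ (α / 2) with hz
      have hz0 : 0 < z := Real.rpow_pos_of_pos ht0 _
      have hzz : z ^ 2 = t ^ α := by
        rw [hz, ← Real.rpow_natCast, ← Real.rpow_mul ht0.le]
        congr 1
        push_cast
        ring
      have hzq : t ^ (α - 1) = z * q := by
        rw [hz, hq, ← Real.rpow_add ht0]
        congr 1
        ring
      have harg : -(lam n) * t ^ α = -((s * z) ^ 2) := by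
        rw [mul_pow, hss, hzz]
        ring
      have e1 := hE1 (s * z) (by positivity)
      have e2 := hE2 (s * z) (by positivity)
      rw [harg, hzq]
      set M1 := mittagLeffler α α (-((s * z) ^ 2))
      set M2 := mittagLeffler α (α - 1) (-((s * z) ^ 2))
      have f1 : (s * z * M1) ^ 2 ≤ C1 ^ 2 := by
        rw [← sq_abs, abs_mul, abs_of_pos (by positivity : 0 < s * z)]
        exact pow_le_pow_left₀ (by positivity) e1 2
      have f2 : M2 ^ 2 ≤ C2 ^ 2 := by
        rw [← sq_abs]
        exact pow_le_pow_left₀ (by positivity) e2 2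
      have g1 : (b n * q) ^ 2 * (s * z * M1) ^ 2 ≤ (b n * q) ^ 2 * C1 ^ 2 :=
        mul_le_mul_of_nonneg_left f1 (by positivity)
      have g2 : lam n * (a n * p) ^ 2 * M2 ^ 2 ≤ lam n * (a n * p) ^ 2 * C2 ^ 2 :=
        mul_le_mul_of_nonneg_left f2 (by positivity)
      have g3 : lam n * (a n * p * M2 + b n * (z * q) * M1) ^ 2 ≤
          2 * (lam n * (a n * p) ^ 2 * M2 ^ 2) + 2 * ((b n * q) ^ 2 * (s * z * M1) ^ 2) := by
        rw [← hss]
        linarith [sq_nonneg (s * (a n * p * M2 - b n * (z * q) * M1)),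
          (by ring : 2 * (s ^ 2 * (a n * p) ^ 2 * M2 ^ 2) + 2 * ((b n * q) ^ 2 * (s * z * M1) ^ 2) =
            s ^ 2 * (a n * p * M2 + b n * (z * q) * M1) ^ 2 +
            (s * (a n * p * M2 - b n * (z * q) * M1)) ^ 2)]
      have g4 : 2 * (lam n * (a n * p) ^ 2 * C2 ^ 2) + 2 * ((b n * q) ^ 2 * C1 ^ 2) =
          2 * (C2 * p) ^ 2 * (lam n * (a n) ^ 2) + 2 * (C1 * q) ^ 2 * (b n) ^ 2 := by ring
      linarith
    have hsum := (ha.mul_left (2 * (C2 * p) ^ 2)).add (hb.mul_left (2 * (C1 * q) ^ 2))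
    have hsum' : Summable fun n => lam n *
            (a n * p * mittagLeffler α (α - 1) (-(lam n) * t ^ α) +
              b n * t ^ (α - 1) * mittagLeffler α α (-(lam n) * t ^ α)) ^ 2 :=
      Summable.of_nonneg_of_le (fun n => mul_nonneg (hlam n).le (sq_nonneg _)) hterm hsum
    have hle := hsum'.tsum_le_tsum hterm hsum
    rw [(ha.mul_left (2 * (C2 * p) ^ 2)).tsum_add (hb.mul_left (2 * (C1 * q) ^ 2)),
      tsum_mul_left, tsum_mul_left, ← hAsq, ← hBsq] at hle
    apply Real.sqrt_le_iff.2
    refine ⟨by positivity, hle.trans ?_⟩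
    have h1 : 0 ≤ C2 * p * A := by positivity
    have h2 : 0 ≤ C1 * q * B := by positivity
    nlinarith [mul_nonneg h1 h2, sq_nonneg (C2 * p * A), sq_nonneg (C1 * q * B)]
  have hi1 : IntervalIntegrable (fun t : ℝ => t ^ (α - 2)) volume 0 T :=
    intervalIntegral.intervalIntegrable_rpow' (by linarith)
  have hi2 : IntervalIntegrable (fun t : ℝ => t ^ (α / 2 - 1)) volume 0 T :=
    intervalIntegral.intervalIntegrable_rpow' (by linarith)
  have hi := (hi1.const_mul (2 * C2 * A)).add (hi2.const_mul (2 * C1 * B))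
  have hi' := (intervalIntegrable_iff_integrableOn_Ioo_of_le hT.le).1 hi
  have hmono := integral_mono_of_nonneg (μ := volume.restrict (Set.Ioo (0:ℝ) T))
    (Filter.Eventually.of_forall fun t => Real.sqrt_nonneg _) hi'
    ((ae_restrict_mem measurableSet_Ioo).mono hpt)
  refine hmono.trans ?_
  have hval : ∫ t in Set.Ioo (0:ℝ) T, (2 * C2 * A * t ^ (α - 2) + 2 * C1 * B * t ^ (α / 2 - 1)) =
      K1 * (T ^ (α - 1) * A) + K2 * (T ^ (α / 2) * B) := by
    rw [← integral_Ioc_eq_integral_Ioo, ← intervalIntegral.integral_of_le hT.le,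
      intervalIntegral.integral_add (hi1.const_mul _) (hi2.const_mul _),
      intervalIntegral.integral_const_mul, intervalIntegral.integral_const_mul,
      integral_rpow (Or.inl (by linarith)), integral_rpow (Or.inl (by linarith)),
      show α - 2 + 1 = α - 1 by ring, show α / 2 - 1 + 1 = α / 2 by ring,
      Real.zero_rpow hα1.ne', Real.zero_rpow hα0.ne', hK1, hK2]
    ring
  refine hval.le.trans ?_
  have h1 : 0 ≤ T ^ (α - 1) * A := by positivity
  have h2 : 0 ≤ T ^ (α / 2) * B := by positivity
  nlinarith [mul_nonneg hK1p.le h2, mul_nonneg hK2p.le h1]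
end
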